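/- Let n be a positive integer with n ≡ 1 (mod 4) and let M = (n-1)/2 or M = n-1. Then Σ_{k=0}^{M} [6k+1]·(q;q²)_k³·(q;q⁴)_k / ((q²;q²)_k·(q⁴;q⁴)_k³) · q^{k²+k} ≡ [n]·q^{(1-n)/4}·((q²;q⁴)_{(n-1)/4} / (q⁴;q⁴)_{(n-1)/4})·(1 − [n]²·Σ_{j=1}^{(n-1)/4} q^{4j}/[4j]²) modulo [n]·Φ_n(q)³. -/

import Mathlib

/-- The q-shifted factorial `(x;q)_k = (1-x)(1-xq)⋯(1-xq^{k-1})`. -/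
def qPoch {K : Type*} [Field K] (x q : K) (k : ℕ) : K :=
  ∏ i ∈ Finset.range k, (1 - x * q ^ i)

/-- The q-integer `[r] = 1 + q + ⋯ + q^{r-1}`. -/
def qint {K : Type*} [Field K] (q : K) (r : ℕ) : K :=
  ∑ i ∈ Finset.range r, q ^ i

open Polynomial Finset

section Contiguity

variable {R S : Type*} [CommRing R] [CommRing S]

/-- The numerator of the `k`-th term of the parametric series, where `w` plays the role of
`a + a⁻¹`. -/
def termNum (q w b : R) (k : ℕ) : R :=
  (1 - q ^ (6 * k + 1)) * q ^ (k ^ 2 + k) *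
    ∏ i ∈ range k, ((1 - q ^ (2 * i + 1)) * (1 - q ^ (2 * i + 1) * w + q ^ (4 * i + 2)) *
      (b - q ^ (4 * i + 1)))

/-- The denominator `∏ (1 - q^{4j} w + q^{8j})` over `1 ≤ j ≤ k`. -/
def denW (q w : R) (k : ℕ) : R :=
  ∏ i ∈ range k, (1 - q ^ (4 * i + 4) * w + q ^ (8 * i + 8))

/-- The denominator `∏ (1 - q^{2j} b)` over `1 ≤ j ≤ k`. -/
def denB (q b : R) (k : ℕ) : R :=
  ∏ i ∈ range k, (1 - q ^ (2 * i + 2) * b)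

/-- The denominator `∏ (1 - q^{4j})` over `1 ≤ j ≤ k`. -/
def denQ (q : R) (k : ℕ) : R :=
  ∏ i ∈ range k, (1 - q ^ (4 * i + 4))

/-- The truncated parametric series multiplied by its common denominator. -/
def truncNum (q w b : R) : ℕ → R
  | 0 => 1 - q
  | N + 1 => (1 - q ^ (4 * N + 4)) * (1 - q ^ (4 * N + 4) * w + q ^ (8 * N + 8)) *
      (1 - q ^ (2 * N + 2) * b) * truncNum q w b N + termNum q w b (N + 1)

theorem map_termNum (f : R →+* S) (q w b : R) (k : ℕ) :
    f (termNum q w b k) = termNum (f q) (f w) (f b) k := by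
  simp [termNum, map_prod]

theorem map_truncNum (f : R →+* S) (q w b : R) (N : ℕ) :
    f (truncNum q w b N) = truncNum (f q) (f w) (f b) N := by
  induction N with
  | zero => simp [truncNum]
  | succ N ih => simp [truncNum, ih, map_termNum]

theorem termNum_shift (q w b : R) (k : ℕ) :
    termNum q w (q ^ 4 * b) (k + 1) =
      (1 - q ^ (6 * k + 7)) * q ^ (k ^ 2 + 3 * k + 2) *
        (∏ i ∈ range (k + 1), ((1 - q ^ (2 * i + 1)) *
          (1 - q ^ (2 * i + 1) * w + q ^ (4 * i + 2)))) *
        ((q ^ 4 * b - q) * (q ^ (4 * k) * ∏ i ∈ range k, (b - q ^ (4 * i + 1)))) := by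
  have h : ∏ i ∈ range (k + 1), (q ^ 4 * b - q ^ (4 * i + 1)) =
      (q ^ 4 * b - q) * (q ^ (4 * k) * ∏ i ∈ range k, (b - q ^ (4 * i + 1))) := by
    have h' : ∏ i ∈ range k, (q ^ 4 * b - q ^ (4 * (i + 1) + 1)) =
        q ^ (4 * k) * ∏ i ∈ range k, (b - q ^ (4 * i + 1)) := by
      induction k with
      | zero => simp
      | succ k ih => rw [prod_range_succ, ih, prod_range_succ]; ring
    rw [prod_range_succ', h']
    ring
  rw [termNum, prod_mul_distrib, h]
  ring

/-- The contiguous relation for the truncated series under `b ↦ q⁴ b`. -/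
theorem truncNum_contiguous (q w b : R) (N : ℕ) :
    (1 - q ^ 3 * b * w + q ^ 6 * b ^ 2) * truncNum q w (q ^ 4 * b) N -
        (1 - q ^ (2 * N + 2) * b) * (1 - q ^ (2 * N + 4) * b) * truncNum q w b N =
      b * q ^ ((N + 1) * (N + 2)) *
        (∏ i ∈ range (N + 1), ((1 - q ^ (2 * i + 1)) *
          (1 - q ^ (2 * i + 1) * w + q ^ (4 * i + 2)))) *
        ∏ i ∈ range N, (b - q ^ (4 * i + 1)) := by
  induction N with
  | zero => simp [truncNum]; ring
  | succ N ih =>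
    have e1 : termNum q w b (N + 1) = (1 - q ^ (6 * N + 7)) * q ^ (N ^ 2 + 3 * N + 2) *
        (∏ i ∈ range (N + 1),
          ((1 - q ^ (2 * i + 1)) * (1 - q ^ (2 * i + 1) * w + q ^ (4 * i + 2)))) *
        ∏ i ∈ range (N + 1), (b - q ^ (4 * i + 1)) := by
      rw [termNum, prod_mul_distrib]; ring
    simp only [truncNum]
    rw [termNum_shift, e1,
      prod_range_succ (fun i => (1 - q ^ (2 * i + 1)) * (1 - q ^ (2 * i + 1) * w + q ^ (4 * i + 2)))
        (N + 1), prod_range_succ (fun i => b - q ^ (4 * i + 1)) N]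
    rw [sub_eq_iff_eq_add] at ih
    generalize (∏ i ∈ range (N + 1),
          ((1 - q ^ (2 * i + 1)) * (1 - q ^ (2 * i + 1) * w + q ^ (4 * i + 2)))) = U at *
    generalize (∏ i ∈ range N, (b - q ^ (4 * i + 1))) = V at *
    generalize truncNum q w b N = A at *
    generalize truncNum q w (q ^ 4 * b) N = B at *
    have p0 : q ^ (4 * N) = (q ^ N) ^ 4 * q ^ 0 := by ring
    have p1 : q ^ (4 * N + 1) = (q ^ N) ^ 4 * q ^ 1 := by ring
    have p2 : q ^ (4 * N + 4) = (q ^ N) ^ 4 * q ^ 4 := by ring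
    have p3 : q ^ (8 * N + 8) = (q ^ N) ^ 8 * q ^ 8 := by ring
    have p4 : q ^ (2 * N + 2) = (q ^ N) ^ 2 * q ^ 2 := by ring
    have p5 : q ^ (2 * N + 4) = (q ^ N) ^ 2 * q ^ 4 := by ring
    have p6 : q ^ (6 * N + 7) = (q ^ N) ^ 6 * q ^ 7 := by ring
    have p7 : q ^ (2 * (N + 1) + 1) = (q ^ N) ^ 2 * q ^ 3 := by ring
    have p8 : q ^ (2 * (N + 1) + 2) = (q ^ N) ^ 2 * q ^ 4 := by ring
    have p9 : q ^ (2 * (N + 1) + 4) = (q ^ N) ^ 2 * q ^ 6 := by ring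
    have p10 : q ^ (4 * (N + 1) + 2) = (q ^ N) ^ 4 * q ^ 6 := by ring
    have e2 : q ^ ((N + 1) * (N + 2)) = q ^ (N ^ 2) * (q ^ N) ^ 3 * q ^ 2 := by ring
    have e3 : q ^ ((N + 1 + 1) * (N + 1 + 2)) = q ^ (N ^ 2) * (q ^ N) ^ 5 * q ^ 6 := by ring
    have e4 : q ^ (N ^ 2 + 3 * N + 2) = q ^ (N ^ 2) * (q ^ N) ^ 3 * q ^ 2 := by ring
    rw [e2, p4, p5] at ih
    rw [e3, e4, p0, p1, p2, p3, p4, p6, p7, p8, p9, p10]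
    generalize q ^ N = Y at *
    generalize q ^ (N ^ 2) = Z at *
    linear_combination (1 - Y ^ 4 * q ^ 4) * (1 - Y ^ 4 * q ^ 4 * w + Y ^ 8 * q ^ 8) *
      (1 - Y ^ 2 * q ^ 6 * b) * ih

theorem denB_shift (q b : R) (N : ℕ) :
    denB q (q ^ 4 * b) N * ((1 - q ^ 2 * b) * (1 - q ^ 4 * b)) =
      denB q b N * ((1 - q ^ (2 * N + 2) * b) * (1 - q ^ (2 * N + 4) * b)) := by
  induction N with
  | zero => simp [denB]
  | succ N ih =>
    simp only [denB, prod_range_succ] at ih ⊢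
    linear_combination (1 - q ^ (2 * N + 2) * (q ^ 4 * b)) * ih

theorem truncNum_self (q w : R) (N : ℕ) :
    truncNum q w q N = (1 - q) * (denQ q N * denW q w N * denB q q N) := by
  induction N with
  | zero => simp [truncNum, denQ, denW, denB]
  | succ N ih =>
    have h : termNum q w q (N + 1) = 0 := by
      rw [termNum, prod_range_succ']; simp
    simp only [truncNum, h, ih, denQ, denW, denB, prod_range_succ]
    ring

end Contiguity

section Vanishing

theorem natDegree_truncNum_le {R : Type*} [CommRing R] (q w : R) (N : ℕ) :
    (truncNum (C q) (C w) X N).natDegree ≤ N := by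
  have hterm (k : ℕ) : (termNum (C q) (C w) X k).natDegree ≤ k := by
    have h : termNum (C q) (C w) X k = C ((1 - q ^ (6 * k + 1)) * q ^ (k ^ 2 + k) *
        ∏ i ∈ range k, ((1 - q ^ (2 * i + 1)) * (1 - q ^ (2 * i + 1) * w + q ^ (4 * i + 2)))) *
        ∏ i ∈ range k, (X - C (q ^ (4 * i + 1))) := by
      simp [termNum, prod_mul_distrib, map_prod, mul_assoc]
    rw [h]
    refine (natDegree_C_mul_le _ _).trans ((natDegree_prod_le _ _).trans ?_)
    refine (sum_le_sum fun i _ => natDegree_X_sub_C_le _).trans (by simp)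
  induction N with
  | zero =>
    have : truncNum (C q) (C w) X 0 = C (1 - q) := by simp [truncNum]
    rw [this]; simp
  | succ N ih =>
    have h : truncNum (C q) (C w) X (N + 1) =
        C ((1 - q ^ (4 * N + 4)) * (1 - q ^ (4 * N + 4) * w + q ^ (8 * N + 8))) *
          ((1 - C (q ^ (2 * N + 2)) * X) * truncNum (C q) (C w) X N) +
          termNum (C q) (C w) X (N + 1) := by
      simp [truncNum, mul_assoc]
    rw [h]
    refine natDegree_add_le_of_degree_le ((natDegree_C_mul_le _ _).trans ?_) (hterm _)
    refine natDegree_mul_le.trans ?_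
    have : (1 - C (q ^ (2 * N + 2)) * X : R[X]).natDegree ≤ 1 := by compute_degree
    lia

theorem eval_truncNum {R : Type*} [CommRing R] (q w b : R) (N : ℕ) :
    (truncNum (C q) (C w) X N).eval b = truncNum q w b N := by
  have := map_truncNum (evalRingHom b) (C q) (C w) X N
  simpa using this

variable {L : Type*} [Field L] {ζ : L} {d N : ℕ}

theorem truncNum_contiguous_of_isPrimitiveRoot (hζ : IsPrimitiveRoot ζ d) (hd : d % 2 = 1)
    (hN : (d - 1) / 2 ≤ N) (w b : L) :
    (1 - ζ ^ 3 * b * w + ζ ^ 6 * b ^ 2) * truncNum ζ w (ζ ^ 4 * b) N =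
        (1 - ζ ^ (2 * N + 2) * b) * (1 - ζ ^ (2 * N + 4) * b) * truncNum ζ w b N := by
  have h := truncNum_contiguous ζ w b N
  have h0 : ∏ i ∈ range (N + 1),
      ((1 - ζ ^ (2 * i + 1)) * (1 - ζ ^ (2 * i + 1) * w + ζ ^ (4 * i + 2))) = 0 := by
    refine prod_eq_zero (i := (d - 1) / 2) (by simp; lia) ?_
    rw [show 2 * ((d - 1) / 2) + 1 = d by lia, hζ.pow_eq_one]
    simp
  rw [h0] at h
  linear_combination h

theorem truncNum_eq_zero_of_pow_ne_one (hζ : IsPrimitiveRoot ζ d) (hd : d % 2 = 1)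
    (hN : (d - 1) / 2 ≤ N) (hN' : N < d) {a : L} (ha0 : a ≠ 0) (ha : a ^ d ≠ 1) (b : L) :
    truncNum ζ (a + a⁻¹) b N = 0 := by
  have hζ0 : ζ ≠ 0 := hζ.ne_zero (by lia)
  set w := a + a⁻¹ with hw
  have hcop : Nat.Coprime 4 d := by
    have : Nat.Coprime 2 d := (Nat.coprime_two_left).2 (Nat.odd_iff.2 hd)
    exact (Nat.Coprime.pow_left 2 this : Nat.Coprime (2 ^ 2) d)
  have hη : IsPrimitiveRoot (ζ ^ 4)⁻¹ d := (hζ.pow_of_coprime 4 hcop).inv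
  set b₀ := (ζ ^ 3 * a)⁻¹ with hb₀
  have hpt (i : ℕ) : truncNum ζ w (b₀ * (ζ ^ 4)⁻¹ ^ i) N = 0 := by
    have hne (e : ℕ) (i : ℕ) : 1 - ζ ^ e * (b₀ * (ζ ^ 4)⁻¹ ^ i) ≠ 0 := by
      intro h
      apply ha
      have h1 : a * (ζ ^ 3 * ζ ^ (4 * i)) = ζ ^ e := by
        rw [hb₀, inv_pow, ← pow_mul] at h
        field_simp at h
        linear_combination h
      have h2 : (a * (ζ ^ 3 * ζ ^ (4 * i))) ^ d = 1 := by
        rw [h1, ← pow_mul, mul_comm, pow_mul, hζ.pow_eq_one, one_pow]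
      rw [← pow_add, mul_pow, ← pow_mul, mul_comm _ d, pow_mul, hζ.pow_eq_one] at h2
      simpa using h2
    induction i with
    | zero =>
      have h := truncNum_contiguous_of_isPrimitiveRoot hζ hd hN w b₀
      have h1 : 1 - ζ ^ 3 * b₀ * w + ζ ^ 6 * b₀ ^ 2 = 0 := by
        rw [hb₀, hw]; field_simp; ring
      have h2 := hne (2 * N + 2) 0
      have h3 := hne (2 * N + 4) 0
      simp only [pow_zero, mul_one] at h2 h3 ⊢
      rw [h1, zero_mul] at h
      simpa [h2, h3] using h.symm
    | succ i ih =>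
      have h := truncNum_contiguous_of_isPrimitiveRoot hζ hd hN w (b₀ * (ζ ^ 4)⁻¹ ^ (i + 1))
      have h1 : ζ ^ 4 * (b₀ * (ζ ^ 4)⁻¹ ^ (i + 1)) = b₀ * (ζ ^ 4)⁻¹ ^ i := by
        rw [pow_succ]
        have : ζ ^ 4 * (ζ ^ 4)⁻¹ = 1 := mul_inv_cancel₀ (pow_ne_zero 4 hζ0)
        linear_combination (b₀ * (ζ ^ 4)⁻¹ ^ i) * this
      rw [h1, ih, mul_zero] at h
      exact (mul_eq_zero.1 h.symm).resolve_left (mul_ne_zero (hne _ _) (hne _ _))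
  have hb₀0 : b₀ ≠ 0 := by rw [hb₀]; positivity
  have hP : truncNum (C ζ) (C w) X N = 0 := by
    refine eq_zero_of_natDegree_lt_card_of_eval_eq_zero _
      (f := fun i : Fin d => b₀ * (ζ ^ 4)⁻¹ ^ (i : ℕ)) ?_ ?_ ?_
    · intro i j hij
      exact Fin.ext (hη.pow_inj i.2 j.2 (mul_left_cancel₀ hb₀0 hij))
    · intro i; rw [eval_truncNum]; exact hpt i
    · simpa using (natDegree_truncNum_le ζ w N).trans_lt hN'
  rw [← eval_truncNum, hP, eval_zero]

/-- At a root of unity of odd order the truncated series vanishes identically. -/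
theorem truncNum_eq_zero_of_isPrimitiveRoot [IsAlgClosed L] (hζ : IsPrimitiveRoot ζ d)
    (hd : d % 2 = 1) (hN : (d - 1) / 2 ≤ N) (hN' : N < d) (w b : L) :
    truncNum ζ w b N = 0 := by
  let p : L[X] := truncNum (C ζ) X (C b) N
  have hp (w : L) : p.eval w = truncNum ζ w b N := by
    have := map_truncNum (evalRingHom w) (C ζ) X (C b) N
    simpa using this
  have hfin : {a : L | a ^ d = 1}.Finite := by
    refine Set.Finite.subset (nthRootsFinset d (1 : L)).finite_toSet fun a ha => ?_
    simpa [mem_nthRootsFinset (show 0 < d by lia)] using ha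
  have hinf : {w : L | p.IsRoot w}.Infinite := by
    refine ((hfin.image fun a => a + a⁻¹).infinite_compl).mono fun w hw => ?_
    obtain ⟨a, ha⟩ := IsAlgClosed.exists_root (C 1 * X ^ 2 + C (-w) * X + C 1 : L[X])
      (by rw [degree_quadratic one_ne_zero]; norm_num)
    have ha' : a ^ 2 - w * a + 1 = 0 := by
      have := IsRoot.def.1 ha
      simp at this
      linear_combination this
    have ha0 : a ≠ 0 := by rintro rfl; simp at ha'
    have hwa : w = a + a⁻¹ := by field_simp; linear_combination -ha'
    have had : a ^ d ≠ 1 := fun h => hw ⟨a, h, hwa.symm⟩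
    change p.eval w = 0
    rw [hp, hwa]
    exact truncNum_eq_zero_of_pow_ne_one hζ hd hN hN' ha0 had b
  rw [← hp, eq_zero_of_infinite_isRoot p hinf, eval_zero]

/-- The truncated series with generic parameters is divisible by the cyclotomic polynomial. -/
theorem cyclotomic_dvd_truncNum {d N : ℕ} (hd : d % 2 = 1) (hN : (d - 1) / 2 ≤ N) (hN' : N < d) :
    C (C (cyclotomic d ℚ)) ∣ truncNum (C (C (X : ℚ[X]))) (C X) X N := by
  have hζ : IsPrimitiveRoot (Complex.exp (2 * Real.pi * Complex.I / d)) d :=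
    Complex.isPrimitiveRoot_exp d (by lia)
  set ζ := Complex.exp (2 * Real.pi * Complex.I / d)
  let f : ℚ[X] →+* ℂ := (aeval ζ : ℚ[X] →ₐ[ℚ] ℂ)
  have h0 : (truncNum (C (C (X : ℚ[X]))) (C X) X N).map (mapRingHom f) = 0 := by
    have h := map_truncNum (mapRingHom (mapRingHom f)) (C (C (X : ℚ[X]))) (C X) X N
    simp only [coe_mapRingHom, map_C, map_X] at h
    rw [h, show f X = ζ by simp [f]]
    refine funext fun r => ?_
    rw [eval_truncNum, eval_zero]
    refine funext fun s => ?_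
    have h := map_truncNum (evalRingHom s) (C ζ) X r N
    simp only [coe_evalRingHom, eval_C, eval_X] at h
    rw [h, truncNum_eq_zero_of_isPrimitiveRoot hζ hd hN hN', eval_zero]
  rw [C_dvd_iff_dvd_coeff]
  intro i
  rw [C_dvd_iff_dvd_coeff]
  intro j
  rw [cyclotomic_eq_minpoly_rat hζ (by lia)]
  refine minpoly.dvd _ _ ?_
  have := congrArg (fun p => (p.coeff i).coeff j) h0
  simpa [f] using this

end Vanishing

section Local

/-- The local ring of rational functions over `ℚ` that are defined at `ζ`. -/
def locAt (ζ : ℂ) : Subring (RatFunc ℚ) where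
  carrier := {x | ∃ u v : ℚ[X], aeval ζ v ≠ 0 ∧
    x = algebraMap ℚ[X] (RatFunc ℚ) u / algebraMap ℚ[X] (RatFunc ℚ) v}
  mul_mem' := by
    rintro _ _ ⟨u, v, hv, rfl⟩ ⟨u', v', hv', rfl⟩
    exact ⟨u * u', v * v', by simp [hv, hv'], by simp [div_mul_div_comm]⟩
  one_mem' := ⟨1, 1, by simp, by simp⟩
  add_mem' := by
    rintro _ _ ⟨u, v, hv, rfl⟩ ⟨u', v', hv', rfl⟩
    have h : v ≠ 0 := by rintro rfl; simp at hv
    have h' : v' ≠ 0 := by rintro rfl; simp at hv'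
    refine ⟨u * v' + v * u', v * v', by simp [hv, hv'], ?_⟩
    rw [div_add_div _ _ (by simpa using h) (by simpa using h')]
    simp
  zero_mem' := ⟨0, 1, by simp, by simp⟩
  neg_mem' := by
    rintro _ ⟨u, v, hv, rfl⟩
    exact ⟨-u, v, hv, by simp [neg_div]⟩

variable {ζ : ℂ} {d : ℕ}

theorem algebraMap_mem_locAt (u : ℚ[X]) : algebraMap ℚ[X] (RatFunc ℚ) u ∈ locAt ζ :=
  ⟨u, 1, by simp, by simp⟩

theorem inv_algebraMap_mem_locAt {v : ℚ[X]} (hv : aeval ζ v ≠ 0) :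
    (algebraMap ℚ[X] (RatFunc ℚ) v)⁻¹ ∈ locAt ζ :=
  ⟨1, v, hv, by simp⟩

theorem X_mem_locAt : RatFunc.X ∈ locAt ζ := by
  simpa using algebraMap_mem_locAt (ζ := ζ) X

theorem inv_X_mem_locAt (hζ : ζ ≠ 0) : RatFunc.X⁻¹ ∈ locAt ζ := by
  simpa using inv_algebraMap_mem_locAt (ζ := ζ) (v := X) (by simpa using hζ)

theorem X_pow_mem_locAt (k : ℕ) : RatFunc.X ^ k ∈ locAt ζ := pow_mem X_mem_locAt k

theorem one_sub_X_pow_mem_locAt (k : ℕ) : 1 - RatFunc.X ^ k ∈ locAt ζ :=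
  sub_mem (one_mem _) (X_pow_mem_locAt k)

theorem inv_one_sub_X_pow_mem_locAt {k : ℕ} (h : ζ ^ k ≠ 1) :
    (1 - RatFunc.X ^ k)⁻¹ ∈ locAt ζ := by
  have := inv_algebraMap_mem_locAt (ζ := ζ) (v := 1 - X ^ k)
    (by simpa [sub_eq_zero] using h.symm)
  simpa using this

theorem ratFunc_X_pow_ne_one {k : ℕ} (hk : k ≠ 0) : (RatFunc.X : RatFunc ℚ) ^ k ≠ 1 := by
  intro h
  have h1 : algebraMap ℚ[X] (RatFunc ℚ) (X ^ k) = algebraMap ℚ[X] (RatFunc ℚ) 1 := by simpa using h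
  have h2 := congrArg natDegree (RatFunc.algebraMap_injective ℚ h1)
  simp at h2
  exact hk h2

theorem one_sub_ratFunc_X_pow_ne_zero {k : ℕ} (hk : k ≠ 0) :
    (1 - RatFunc.X ^ k : RatFunc ℚ) ≠ 0 :=
  sub_ne_zero.2 (ratFunc_X_pow_ne_one hk).symm

theorem div_one_sub_X_pow_mem_locAt (hζ : IsPrimitiveRoot ζ d) {s c : ℕ} (hs : d ∣ s) (hc : c ≠ 0) :
    (1 - RatFunc.X ^ s) * (1 - RatFunc.X ^ c)⁻¹ ∈ locAt ζ := by
  by_cases h : d ∣ c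
  · obtain ⟨s, rfl⟩ := hs
    obtain ⟨c, rfl⟩ := h
    have hd0 : d ≠ 0 := by rintro rfl; simp at hc
    have hc0 : c ≠ 0 := by rintro rfl; simp at hc
    have e (t : ℕ) : (1 - RatFunc.X ^ (d * t) : RatFunc ℚ) =
        (1 - RatFunc.X ^ d) * algebraMap ℚ[X] (RatFunc ℚ) (∑ i ∈ range t, (X ^ d) ^ i) := by
      have := mul_neg_geom_sum ((RatFunc.X : RatFunc ℚ) ^ d) t
      rw [pow_mul, ← this]; simp
    have h1 : (1 - RatFunc.X ^ d : RatFunc ℚ) ≠ 0 := one_sub_ratFunc_X_pow_ne_zero hd0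
    rw [e, e, mul_inv, mul_mul_mul_comm, mul_inv_cancel₀ h1, one_mul]
    refine mul_mem (algebraMap_mem_locAt _) (inv_algebraMap_mem_locAt ?_)
    simp [hζ.pow_eq_one, hc0]
  · exact mul_mem (one_sub_X_pow_mem_locAt _)
      (inv_one_sub_X_pow_mem_locAt fun h' => h (hζ.dvd_of_pow_eq_one _ h'))

theorem exists_lt_dvd_add_mul {c d : ℕ} (hd : d ≠ 0) (hcd : Nat.Coprime c d) (a : ℕ) :
    ∃ i < d, d ∣ a + c * i := by
  have : NeZero d := ⟨hd⟩
  refine ⟨(-(a : ZMod d) * (c : ZMod d)⁻¹).val, ZMod.val_lt _, ?_⟩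
  rw [← ZMod.natCast_eq_zero_iff]
  have := ZMod.coe_mul_inv_eq_one c hcd
  push_cast
  rw [ZMod.natCast_val, ZMod.cast_id]
  linear_combination -(a : ZMod d) * this

theorem prod_div_prod_mem_locAt (hζ : IsPrimitiveRoot ζ d) (hd : d ≠ 0) {c : ℕ} (hc : c ≠ 0)
    (hcd : Nat.Coprime c d) (e k : ℕ) :
    (∏ i ∈ range k, (1 - RatFunc.X ^ (e + c * i))) *
      (∏ i ∈ range k, (1 - RatFunc.X ^ (c * i + c)))⁻¹ ∈ locAt ζ := by
  induction k using Nat.strong_induction_on with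
  | _ k ih =>
  have hunit {i : ℕ} (hi : ¬ d ∣ i + 1) : (1 - RatFunc.X ^ (c * i + c))⁻¹ ∈ locAt ζ := by
    refine inv_one_sub_X_pow_mem_locAt fun h => hi ?_
    have := hζ.dvd_of_pow_eq_one _ h
    rw [show c * i + c = c * (i + 1) by ring] at this
    exact hcd.symm.dvd_of_dvd_mul_left this
  by_cases hk : k < d
  · refine mul_mem (prod_mem fun i _ => one_sub_X_pow_mem_locAt _) ?_
    rw [← prod_inv_distrib]
    refine prod_mem fun i hi => hunit fun h => ?_
    have := Nat.le_of_dvd (by lia) h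
    simp at hi
    lia
  · obtain ⟨k, rfl⟩ : ∃ k', k = k' + d := ⟨k - d, by lia⟩
    obtain ⟨i₀, hi₀, h₀⟩ := exists_lt_dvd_add_mul hd hcd (e + c * k)
    obtain ⟨i₁, hi₁, h₁⟩ := exists_lt_dvd_add_mul hd (Nat.coprime_one_left d) (k + 1)
    rw [prod_range_add, prod_range_add, mul_inv, mul_mul_mul_comm]
    refine mul_mem (ih k (by lia)) ?_
    rw [← mul_prod_erase _ _ (mem_range.2 hi₀),
      ← mul_prod_erase _ (fun i => 1 - RatFunc.X ^ (c * (k + i) + c)) (mem_range.2 hi₁),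
      mul_inv, mul_mul_mul_comm, ← prod_inv_distrib]
    refine mul_mem (div_one_sub_X_pow_mem_locAt hζ ?_ (by positivity))
      (mul_mem (prod_mem fun i _ => one_sub_X_pow_mem_locAt _) (prod_mem fun i hi => hunit ?_))
    · convert h₀ using 1; ring
    · intro h
      simp only [mem_erase, mem_range] at hi
      have h2 : k + 1 + 1 * i₁ ≡ k + 1 + 1 * i [MOD d] :=
        ((Nat.modEq_zero_iff_dvd.2 h₁).trans
          (Nat.modEq_zero_iff_dvd.2 (by convert h using 1; ring)).symm)
      have h3 := Nat.ModEq.add_left_cancel' _ h2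
      rw [one_mul, one_mul] at h3
      exact hi.1 (Nat.ModEq.eq_of_lt_of_lt h3 hi₁ hi.2).symm

/-- `x` is divisible by the `e`-th power of the uniformizer of the local ring at `ζ`. -/
def LocDvd (ζ : ℂ) (e : ℕ) (x : RatFunc ℚ) : Prop :=
  ∃ y ∈ locAt ζ, x = algebraMap ℚ[X] (RatFunc ℚ) (minpoly ℚ ζ) ^ e * y

variable {x y : RatFunc ℚ} {e f : ℕ}

theorem LocDvd.add (hx : LocDvd ζ e x) (hy : LocDvd ζ e y) : LocDvd ζ e (x + y) := by
  obtain ⟨u, hu, rfl⟩ := hx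
  obtain ⟨v, hv, rfl⟩ := hy
  exact ⟨u + v, add_mem hu hv, by ring⟩

theorem LocDvd.neg (hx : LocDvd ζ e x) : LocDvd ζ e (-x) := by
  obtain ⟨u, hu, rfl⟩ := hx
  exact ⟨-u, neg_mem hu, by ring⟩

theorem LocDvd.sub (hx : LocDvd ζ e x) (hy : LocDvd ζ e y) : LocDvd ζ e (x - y) := by
  rw [sub_eq_add_neg]; exact hx.add hy.neg

theorem LocDvd.mul (hx : LocDvd ζ e x) (hy : LocDvd ζ f y) : LocDvd ζ (e + f) (x * y) := by
  obtain ⟨u, hu, rfl⟩ := hx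
  obtain ⟨v, hv, rfl⟩ := hy
  exact ⟨u * v, mul_mem hu hv, by ring⟩

theorem LocDvd.pow (hx : LocDvd ζ e x) (k : ℕ) : LocDvd ζ (e * k) (x ^ k) := by
  obtain ⟨u, hu, rfl⟩ := hx
  exact ⟨u ^ k, pow_mem hu k, by ring⟩

theorem LocDvd.mul_right (hx : LocDvd ζ e x) (hy : y ∈ locAt ζ) : LocDvd ζ e (x * y) := by
  obtain ⟨u, hu, rfl⟩ := hx
  exact ⟨u * y, mul_mem hu hy, by ring⟩

theorem LocDvd.mul_left (hx : x ∈ locAt ζ) (hy : LocDvd ζ e y) : LocDvd ζ e (x * y) := by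
  rw [mul_comm]; exact hy.mul_right hx

theorem LocDvd.of_le (hx : LocDvd ζ e x) (h : f ≤ e) : LocDvd ζ f x := by
  obtain ⟨u, hu, rfl⟩ := hx
  obtain ⟨e, rfl⟩ := Nat.exists_eq_add_of_le h
  exact ⟨_, mul_mem (pow_mem (algebraMap_mem_locAt (minpoly ℚ ζ)) e) hu, by ring⟩

theorem LocDvd.mem (hx : LocDvd ζ e x) : x ∈ locAt ζ := by
  obtain ⟨u, hu, rfl⟩ := hx
  exact mul_mem (pow_mem (algebraMap_mem_locAt _) e) hu

theorem LocDvd.sum {ι : Type*} {s : Finset ι} {g : ι → RatFunc ℚ}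
    (h : ∀ i ∈ s, LocDvd ζ e (g i)) : LocDvd ζ e (∑ i ∈ s, g i) :=
  sum_induction g (LocDvd ζ e) (fun _ _ => LocDvd.add) ⟨0, zero_mem _, by simp⟩ h

theorem locDvd_algebraMap {u : ℚ[X]} (hu : aeval ζ u = 0) :
    LocDvd ζ 1 (algebraMap ℚ[X] (RatFunc ℚ) u) := by
  obtain ⟨v, rfl⟩ := minpoly.dvd _ _ hu
  exact ⟨_, algebraMap_mem_locAt v, by simp⟩

theorem locDvd_one_sub_X_pow {k : ℕ} (h : ζ ^ k = 1) : LocDvd ζ 1 (1 - RatFunc.X ^ k) := by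
  have := locDvd_algebraMap (ζ := ζ) (u := 1 - X ^ k) (by simp [h])
  simpa using this

theorem LocDvd.minpoly_pow_dvd_num (hζ : IsIntegral ℚ ζ) (h : LocDvd ζ e x) :
    minpoly ℚ ζ ^ e ∣ x.num := by
  obtain ⟨_, ⟨u, v, hv, rfl⟩, h⟩ := h
  have hv0 : v ≠ 0 := by rintro rfl; simp at hv
  have hcop : IsCoprime (minpoly ℚ ζ ^ e) v := by
    refine IsCoprime.pow_left (((minpoly.irreducible hζ).coprime_iff_not_dvd).2 ?_)
    rintro ⟨r, rfl⟩
    simp at hv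
  refine hcop.dvd_of_dvd_mul_right ?_
  have hx : algebraMap ℚ[X] (RatFunc ℚ) x.num = x * algebraMap ℚ[X] (RatFunc ℚ) x.denom := by
    rw [← div_eq_iff (by simpa using x.denom_ne_zero), RatFunc.num_div_denom]
  refine ⟨u * x.denom, RatFunc.algebraMap_injective ℚ ?_⟩
  have hv' : algebraMap ℚ[X] (RatFunc ℚ) v ≠ 0 := by simpa using hv0
  rw [map_mul, hx, h]
  simp only [map_mul, map_pow]
  field_simp

end Local

section Mixed

variable {R S : Type*} [CommRing R] [CommRing S]

theorem map_denW (f : R →+* S) (q w : R) (N : ℕ) : f (denW q w N) = denW (f q) (f w) N := by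
  simp [denW, map_prod]

theorem map_denB (f : R →+* S) (q b : R) (N : ℕ) : f (denB q b N) = denB (f q) (f b) N := by
  simp [denB, map_prod]

theorem sub_dvd_eval_mul_eval_sub (h g : R[X]) (x y : R) :
    x - y ∣ h.eval x * g.eval y - h.eval y * g.eval x := by
  have e : h.eval x * g.eval y - h.eval y * g.eval x =
      g.eval y * (h.eval x - h.eval y) - h.eval y * (g.eval x - g.eval y) := by ring
  rw [e]
  exact dvd_sub ((h.sub_dvd_eval_sub x y).mul_left _) ((g.sub_dvd_eval_sub x y).mul_left _)

theorem sub_mul_sub_dvd_mixed (p : R[X][X]) (f g : R[X]) (w₀ w₁ b₀ b₁ : R) :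
    (w₀ - w₁) * (b₀ - b₁) ∣
      (p.map (evalRingHom w₀)).eval b₀ * f.eval w₁ * g.eval b₁ -
      (p.map (evalRingHom w₁)).eval b₀ * f.eval w₀ * g.eval b₁ -
      (p.map (evalRingHom w₀)).eval b₁ * f.eval w₁ * g.eval b₀ +
      (p.map (evalRingHom w₁)).eval b₁ * f.eval w₀ * g.eval b₀ := by
  obtain ⟨h, hh⟩ : C (w₀ - w₁) ∣ p.map (evalRingHom w₀) * C (f.eval w₁) -
      p.map (evalRingHom w₁) * C (f.eval w₀) := by
    rw [C_dvd_iff_dvd_coeff]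
    intro i
    simpa using sub_dvd_eval_mul_eval_sub (p.coeff i) f w₀ w₁
  have e (b : R) := congrArg (eval b) hh
  simp only [eval_sub, eval_mul, eval_C] at e
  obtain ⟨z, hz⟩ := sub_dvd_eval_mul_eval_sub h g b₀ b₁
  exact ⟨z, by linear_combination g.eval b₁ * e b₀ - g.eval b₀ * e b₁ + (w₀ - w₁) * hz⟩

variable {d N : ℕ}

theorem exists_truncNum_eq_mul_eval (hd : d % 2 = 1) (hN : (d - 1) / 2 ≤ N) (hN' : N < d)
    (f : ℚ[X] →+* R) : ∃ p : R[X][X], ∀ w b : R,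
      truncNum (f X) w b N = f (cyclotomic d ℚ) * (p.map (evalRingHom w)).eval b := by
  obtain ⟨p, hp⟩ := cyclotomic_dvd_truncNum hd hN hN'
  refine ⟨p.map (mapRingHom f), fun w b => ?_⟩
  let g : ℚ[X][X][X] →+* R := (evalRingHom b).comp
    ((mapRingHom (evalRingHom w)).comp (mapRingHom (mapRingHom f)))
  have h := map_truncNum g (C (C (X : ℚ[X]))) (C X) X N
  rw [hp, map_mul] at h
  have h1 : g (C (C X)) = f X := by simp [g]
  have h2 : g (C X) = w := by simp [g]
  have h3 : g X = b := by simp [g]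
  have h4 : g (C (C (cyclotomic d ℚ))) = f (cyclotomic d ℚ) := by simp [g]
  rw [h1, h2, h3, h4] at h
  exact h.symm

theorem cyclotomic_mul_dvd_mixed_truncNum (hd : d % 2 = 1) (hN : (d - 1) / 2 ≤ N) (hN' : N < d)
    (f : ℚ[X] →+* R) (w₀ w₁ b₀ b₁ : R) :
    f (cyclotomic d ℚ) * ((w₀ - w₁) * (b₀ - b₁)) ∣
      truncNum (f X) w₀ b₀ N * denW (f X) w₁ N * denB (f X) b₁ N -
      truncNum (f X) w₁ b₀ N * denW (f X) w₀ N * denB (f X) b₁ N -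
      truncNum (f X) w₀ b₁ N * denW (f X) w₁ N * denB (f X) b₀ N +
      truncNum (f X) w₁ b₁ N * denW (f X) w₀ N * denB (f X) b₀ N := by
  obtain ⟨p, hp⟩ := exists_truncNum_eq_mul_eval hd hN hN' f
  have hW (w : R) : (denW (C (f X)) X N).eval w = denW (f X) w N := by
    simpa using map_denW (evalRingHom w) (C (f X)) X N
  have hB (b : R) : (denB (C (f X)) X N).eval b = denB (f X) b N := by
    simpa using map_denB (evalRingHom b) (C (f X)) X N
  obtain ⟨z, hz⟩ := sub_mul_sub_dvd_mixed p (denW (C (f X)) X N) (denB (C (f X)) X N) w₀ w₁ b₀ b₁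
  simp only [hW, hB] at hz
  simp only [hp]
  exact ⟨z, by linear_combination f (cyclotomic d ℚ) * hz⟩

theorem cyclotomic_mul_dvd_cross_truncNum (hd : d % 2 = 1) (hN : (d - 1) / 2 ≤ N) (hN' : N < d)
    (f : ℚ[X] →+* R) (w b₀ b₁ : R) :
    f (cyclotomic d ℚ) * (b₀ - b₁) ∣
      truncNum (f X) w b₀ N * denB (f X) b₁ N - truncNum (f X) w b₁ N * denB (f X) b₀ N := by
  obtain ⟨p, hp⟩ := exists_truncNum_eq_mul_eval hd hN hN' f
  have hB (b : R) : (denB (C (f X)) X N).eval b = denB (f X) b N := by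
    simpa using map_denB (evalRingHom b) (C (f X)) X N
  obtain ⟨z, hz⟩ := sub_dvd_eval_mul_eval_sub (p.map (evalRingHom w)) (denB (C (f X)) X N) b₀ b₁
  simp only [hB] at hz
  simp only [hp]
  exact ⟨z, by linear_combination f (cyclotomic d ℚ) * hz⟩

end Mixed

section Evaluation

variable {K : Type*} [CommRing K]

/-- Evaluation of the truncated series at `b = q^{4j+1}`, where it terminates. -/
theorem truncNum_pow (q w : K) {N j : ℕ} (hj : j ≤ N) :
    denW q w j * truncNum q w (q ^ (4 * j + 1)) N =
      (1 - q) * (∏ i ∈ range j, ((1 - q ^ (4 * i + 3)) * (1 - q ^ (4 * i + 5)))) *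
        (denQ q N * denW q w N * denB q (q ^ (4 * j + 1)) N) := by
  induction j with
  | zero => simp [denW, truncNum_self]
  | succ j ih =>
    have h1 := truncNum_contiguous q w (q ^ (4 * j + 1)) N
    have h2 := denB_shift q (q ^ (4 * j + 1)) N
    have h0 : ∏ i ∈ range N, (q ^ (4 * j + 1) - q ^ (4 * i + 1)) = 0 :=
      prod_eq_zero (mem_range.2 hj) (sub_self _)
    rw [h0, mul_zero, sub_eq_zero] at h1
    rw [show 4 * (j + 1) + 1 = 4 + (4 * j + 1) by ring, pow_add]
    have h3 : denW q w (j + 1) = denW q w j *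
        (1 - q ^ 3 * q ^ (4 * j + 1) * w + q ^ 6 * (q ^ (4 * j + 1)) ^ 2) := by
      rw [denW, prod_range_succ, ← denW]; ring
    have h4 : q ^ 2 * q ^ (4 * j + 1) = q ^ (4 * j + 3) := by ring
    have h5 : q ^ 4 * q ^ (4 * j + 1) = q ^ (4 * j + 5) := by ring
    rw [h3, mul_assoc, h1, prod_range_succ]
    specialize ih (by lia)
    rw [h4, h5] at h2
    rw [h5]
    linear_combination (1 - q ^ (2 * N + 2) * q ^ (4 * j + 1)) *
      (1 - q ^ (2 * N + 4) * q ^ (4 * j + 1)) * ih -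
      (1 - q) * (∏ i ∈ range j, ((1 - q ^ (4 * i + 3)) * (1 - q ^ (4 * i + 5)))) *
        denQ q N * denW q w N * h2

/-- The polynomial in `b` proportional to the truncated series at `w = q^n + q^{-n}`. -/
def evalPoly (q b : K) (m : ℕ) : K :=
  ∏ i ∈ range m, ((q ^ (4 * i + 2) - b) * (1 - q ^ (4 * i + 2) * b))

theorem evalPoly_shift (q b : K) (m : ℕ) :
    (q ^ (4 * m) - q ^ 2 * b) * evalPoly q (q ^ 4 * b) m * (1 - q ^ 2 * b) =
      q ^ (4 * m) * (1 - q ^ (4 * m + 2) * b) * evalPoly q b m * (1 - q ^ 2 * b) := by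
  induction m with
  | zero => simp [evalPoly]
  | succ m ih =>
    simp only [evalPoly, prod_range_succ] at ih ⊢
    have e1 : q ^ (4 * (m + 1)) = (q ^ m) ^ 4 * q ^ 4 := by ring
    have e2 : q ^ (4 * m) = (q ^ m) ^ 4 := by ring
    have e3 : q ^ (4 * m + 2) = (q ^ m) ^ 4 * q ^ 2 := by ring
    have e4 : q ^ (4 * (m + 1) + 2) = (q ^ m) ^ 4 * q ^ 6 := by ring
    rw [e2, e3] at ih
    rw [e1, e3, e4]
    generalize q ^ m = Y at *
    linear_combination q ^ 4 * (Y ^ 4 * q ^ 2 - b) * (1 - Y ^ 4 * q ^ 6 * b) * ih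

end Evaluation

section Field

variable {K : Type*} [Field K] {q w : K}

theorem truncNum_pow_mul_evalPoly (hq0 : q ≠ 0) (hq : ∀ k ≠ 0, 1 - q ^ k ≠ 0) {m : ℕ}
    (hw : w = q ^ (4 * m + 1) + (q ^ (4 * m + 1))⁻¹) (j : ℕ) :
    truncNum q w (q ^ (4 * j + 1)) (2 * m) * evalPoly q q m =
      evalPoly q (q ^ (4 * j + 1)) m * truncNum q w q (2 * m) := by
  induction j with
  | zero => simp; ring
  | succ j ih =>
    set b := q ^ (4 * j + 1) with hb
    have hb' : q ^ (4 * (j + 1) + 1) = q ^ 4 * b := by rw [hb]; ring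
    rw [hb']
    have h1 := truncNum_contiguous q w b (2 * m)
    have h0 : ∏ i ∈ range (2 * m + 1),
        ((1 - q ^ (2 * i + 1)) * (1 - q ^ (2 * i + 1) * w + q ^ (4 * i + 2))) = 0 := by
      refine prod_eq_zero (i := 2 * m) (by simp) ?_
      rw [hw]
      field_simp
      ring
    rw [h0, mul_zero, zero_mul, sub_eq_zero] at h1
    have h2 : q ^ (4 * m) * (1 - q ^ 3 * b * w + q ^ 6 * b ^ 2) =
        (1 - q ^ (4 * m + 4) * b) * (q ^ (4 * m) - q ^ 2 * b) := by
      rw [hw]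
      field_simp
      ring
    have h3 : 1 - q ^ (4 * m + 4) * b ≠ 0 := by
      rw [hb, ← pow_add]; exact hq _ (by lia)
    have h4 : 1 - q ^ 2 * b ≠ 0 := by
      rw [hb, ← pow_add]; exact hq _ (by lia)
    have h5 : q ^ (4 * m) - q ^ 2 * b ≠ 0 := by
      rw [hb, ← pow_add]
      intro h
      rcases lt_or_ge (4 * m) (2 + (4 * j + 1)) with hlt | hge
      · obtain ⟨r, hr⟩ := Nat.exists_eq_add_of_lt hlt
        rw [hr] at h
        refine hq (r + 1) (by lia) ((mul_eq_zero.1 (?_ : q ^ (4 * m) * _ = 0)).resolve_left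
          (pow_ne_zero _ hq0))
        rw [← h]; ring
      · obtain ⟨r, hr⟩ := Nat.exists_eq_add_of_le hge
        rw [hr] at h
        refine hq r (by lia) ((mul_eq_zero.1 (?_ : q ^ (2 + (4 * j + 1)) * _ = 0)).resolve_left
          (pow_ne_zero _ hq0))
        rw [← neg_eq_zero, ← h]; ring
    have h6 := mul_right_cancel₀ h4 (evalPoly_shift q b m)
    have h7 : (q ^ (4 * m) - q ^ 2 * b) * truncNum q w (q ^ 4 * b) (2 * m) =
        q ^ (4 * m) * (1 - q ^ (4 * m + 2) * b) * truncNum q w b (2 * m) := by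
      refine mul_left_cancel₀ h3 ?_
      rw [← mul_assoc, ← h2, mul_assoc, h1]
      ring
    refine mul_left_cancel₀ h5 ?_
    linear_combination evalPoly q q m * h7 - truncNum q w q (2 * m) * h6 +
      q ^ (4 * m) * (1 - q ^ (4 * m + 2) * b) * ih

theorem truncNum_one_mul_evalPoly (hq0 : q ≠ 0) (hq : ∀ k ≠ 0, 1 - q ^ k ≠ 0) {m : ℕ}
    (hw : w = q ^ (4 * m + 1) + (q ^ (4 * m + 1))⁻¹) :
    truncNum q w 1 (2 * m) * evalPoly q q m = evalPoly q 1 m * truncNum q w q (2 * m) := by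
  let p₁ : K[X] := truncNum (C q) (C w) X (2 * m) * C (evalPoly q q m)
  let p₂ : K[X] := (∏ i ∈ range m, ((C (q ^ (4 * i + 2)) - X) * (1 - C (q ^ (4 * i + 2)) * X))) *
    C (truncNum q w q (2 * m))
  have e₁ (b : K) : p₁.eval b = truncNum q w b (2 * m) * evalPoly q q m := by
    simp [p₁, eval_truncNum]
  have e₂ (b : K) : p₂.eval b = evalPoly q b m * truncNum q w q (2 * m) := by
    simp [p₂, evalPoly, eval_prod]
  have hinj : Function.Injective fun j : ℕ => q ^ (4 * j + 1) := by
    intro i j hij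
    by_contra hne
    wlog hlt : i < j generalizing i j
    · exact this hij.symm (Ne.symm hne) (by lia)
    obtain ⟨r, rfl⟩ := Nat.exists_eq_add_of_lt hlt
    refine hq (4 * (r + 1)) (by lia) ((mul_eq_zero.1 (?_ : q ^ (4 * i + 1) * _ = 0)).resolve_left
      (pow_ne_zero _ hq0))
    rw [mul_sub, sub_eq_zero, mul_one]
    refine hij.trans ?_
    ring
  have h : p₁ = p₂ := by
    refine eq_of_infinite_eval_eq _ _ ((Set.infinite_range_of_injective hinj).mono ?_)
    rintro _ ⟨j, rfl⟩
    change p₁.eval _ = p₂.eval _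
    rw [e₁, e₂, truncNum_pow_mul_evalPoly hq0 hq hw]
  rw [← e₁, h, e₂]

theorem prod_range_two_mul {M : Type*} [CommMonoid M] (f : ℕ → M) (m : ℕ) :
    ∏ i ∈ range (2 * m), f i = ∏ i ∈ range m, (f (2 * i) * f (2 * i + 1)) := by
  induction m with
  | zero => simp
  | succ m ih => rw [mul_add, mul_one, prod_range_succ, prod_range_succ, prod_range_succ, ih,
      mul_assoc]

/-- Evaluation of the truncated series at `w = q^n + q^{-n}`, `b = 1`. -/
theorem truncNum_one (hq0 : q ≠ 0) (hq : ∀ k ≠ 0, 1 - q ^ k ≠ 0) {m : ℕ}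
    (hw : w = q ^ (4 * m + 1) + (q ^ (4 * m + 1))⁻¹) :
    truncNum q w 1 (2 * m) * (q ^ m * ∏ i ∈ range m, (1 - q ^ (4 * i + 4))) =
      (1 - q ^ (4 * m + 1)) * (∏ i ∈ range m, (1 - q ^ (4 * i + 2))) *
        (denQ q (2 * m) * denW q w (2 * m) * denB q 1 (2 * m)) := by
  have h := truncNum_one_mul_evalPoly hq0 hq hw
  rw [truncNum_self] at h
  have hne (a c : ℕ) (hc : c ≠ 0) : ∏ i ∈ range m, (1 - q ^ (a * i + c)) ≠ 0 :=
    prod_ne_zero_iff.2 fun i _ => hq _ (by lia)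
  have e1 : evalPoly q 1 m = (-1) ^ m * (∏ i ∈ range m, (1 - q ^ (4 * i + 2))) ^ 2 := by
    rw [evalPoly, ← prod_pow, ← card_range m, ← prod_const, card_range, ← prod_mul_distrib]
    exact prod_congr rfl fun i _ => by ring
  have e2 : evalPoly q q m = (-1) ^ m * q ^ m * (∏ i ∈ range m, (1 - q ^ (4 * i + 1))) *
      ∏ i ∈ range m, (1 - q ^ (4 * i + 3)) := by
    rw [← mul_pow, evalPoly, ← card_range m, ← prod_const, card_range, ← prod_mul_distrib,
      ← prod_mul_distrib]
    exact prod_congr rfl fun i _ => by ring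
  have e3 : denB q q (2 * m) = (∏ i ∈ range m, (1 - q ^ (4 * i + 3))) *
      ∏ i ∈ range m, (1 - q ^ (4 * i + 5)) := by
    rw [denB, prod_range_two_mul, ← prod_mul_distrib]
    exact prod_congr rfl fun i _ => by ring
  have e4 : denB q 1 (2 * m) = (∏ i ∈ range m, (1 - q ^ (4 * i + 2))) *
      ∏ i ∈ range m, (1 - q ^ (4 * i + 4)) := by
    rw [denB, prod_range_two_mul, ← prod_mul_distrib]
    exact prod_congr rfl fun i _ => by ring
  have e5 : (1 - q) * ∏ i ∈ range m, (1 - q ^ (4 * i + 5)) =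
      (∏ i ∈ range m, (1 - q ^ (4 * i + 1))) * (1 - q ^ (4 * m + 1)) := by
    rw [← prod_range_succ (fun i => 1 - q ^ (4 * i + 1)), prod_range_succ', mul_comm]
    simp [mul_add, add_assoc]
  have h1 := hne 4 1 one_ne_zero
  have h3 := hne 4 3 three_ne_zero
  rw [e1, e2, e3] at h
  rw [e4]
  have hs : ((-1 : K) ^ m) ≠ 0 := pow_ne_zero _ (by simp)
  generalize (∏ i ∈ range m, (1 - q ^ (4 * i + 1))) = A1 at *
  generalize (∏ i ∈ range m, (1 - q ^ (4 * i + 2))) = A2 at *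
  generalize (∏ i ∈ range m, (1 - q ^ (4 * i + 3))) = A3 at *
  generalize (∏ i ∈ range m, (1 - q ^ (4 * i + 4))) = A4 at *
  generalize (∏ i ∈ range m, (1 - q ^ (4 * i + 5))) = A5 at *
  refine mul_left_cancel₀ (mul_ne_zero hs (mul_ne_zero h1 h3)) ?_
  linear_combination A4 * h + (-1) ^ m * A2 ^ 2 * denQ q (2 * m) * denW q w (2 * m) * A3 * A4 * e5

end Field

section LocalTruncNum

variable {ζ : ℂ} {d N : ℕ}

theorem LocDvd.inv_one_sub_mem {y : RatFunc ℚ} (hy : LocDvd ζ 1 y) :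
    (1 - y)⁻¹ ∈ locAt ζ := by
  obtain ⟨_, ⟨u, v, hv, rfl⟩, rfl⟩ := hy
  have hv0 : algebraMap ℚ[X] (RatFunc ℚ) v ≠ 0 := by
    rw [Ne, FaithfulSMul.algebraMap_eq_zero_iff]; rintro rfl; simp at hv
  refine ⟨v, v - minpoly ℚ ζ * u, by simpa using hv, ?_⟩
  rw [map_sub, map_mul, pow_one, mul_div_assoc', one_sub_div hv0, inv_div]

theorem LocDvd.ne_one {y : RatFunc ℚ} (hy : LocDvd ζ 1 y) : y ≠ 1 := by
  obtain ⟨_, ⟨u, v, hv, rfl⟩, rfl⟩ := hy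
  have hv0 : algebraMap ℚ[X] (RatFunc ℚ) v ≠ 0 := by
    rw [Ne, FaithfulSMul.algebraMap_eq_zero_iff]; rintro rfl; simp at hv
  rw [pow_one, mul_div_assoc', Ne, div_eq_one_iff_eq hv0, ← map_mul]
  intro h
  rw [← RatFunc.algebraMap_injective ℚ h] at hv
  simp at hv

theorem LocDvd.prod_one_sub {ι : Type*} (s : Finset ι) {e : ℕ} {g : ι → RatFunc ℚ}
    (h : ∀ i ∈ s, LocDvd ζ e (g i)) :
    LocDvd ζ (e * 2) (∏ i ∈ s, (1 - g i) - (1 - ∑ i ∈ s, g i)) := by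
  classical
  induction s using Finset.induction_on with
  | empty => rw [prod_empty, sum_empty, sub_zero, sub_self]; exact ⟨0, zero_mem _, by simp⟩
  | insert a s ha ih =>
    rw [prod_insert ha, sum_insert ha]
    have h1 : LocDvd ζ e (∑ i ∈ s, g i) := LocDvd.sum fun i hi => h i (mem_insert_of_mem hi)
    have h2 := h a (mem_insert_self _ _)
    have h3 := ih fun i hi => h i (mem_insert_of_mem hi)
    have h4 := (h2.mul h1).of_le (f := e * 2) (by lia)
    have h5 := (h3.mul_left (sub_mem (one_mem _) h2.mem)).add h4
    convert h5 using 1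
    ring

theorem locDvd_cyclotomic (hζ : IsPrimitiveRoot ζ d) (hd : d ≠ 0) :
    LocDvd ζ 1 (algebraMap ℚ[X] (RatFunc ℚ) (cyclotomic d ℚ)) := by
  refine locDvd_algebraMap ?_
  have := hζ.isRoot_cyclotomic (Nat.pos_of_ne_zero hd)
  rwa [IsRoot.def, ← map_cyclotomic d (algebraMap ℚ ℂ), eval_map_algebraMap] at this

theorem locDvd_mixed_truncNum (hζ : IsPrimitiveRoot ζ d) (hd : d % 2 = 1)
    (hN : (d - 1) / 2 ≤ N) (hN' : N < d) {w₀ w₁ b₀ b₁ : RatFunc ℚ} (hw₀ : w₀ ∈ locAt ζ)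
    (hw₁ : w₁ ∈ locAt ζ) (hb₀ : b₀ ∈ locAt ζ) (hb₁ : b₁ ∈ locAt ζ) {e f : ℕ}
    (he : LocDvd ζ e (w₀ - w₁)) (hf : LocDvd ζ f (b₀ - b₁)) :
    LocDvd ζ (1 + (e + f))
      (truncNum RatFunc.X w₀ b₀ N * denW RatFunc.X w₁ N * denB RatFunc.X b₁ N -
      truncNum RatFunc.X w₁ b₀ N * denW RatFunc.X w₀ N * denB RatFunc.X b₁ N -
      truncNum RatFunc.X w₀ b₁ N * denW RatFunc.X w₁ N * denB RatFunc.X b₀ N +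
      truncNum RatFunc.X w₁ b₁ N * denW RatFunc.X w₀ N * denB RatFunc.X b₀ N) := by
  let φ : ℚ[X] →+* locAt ζ :=
    (algebraMap ℚ[X] (RatFunc ℚ)).codRestrict (locAt ζ) algebraMap_mem_locAt
  have hφ : (locAt ζ).subtype (φ X) = RatFunc.X := RatFunc.algebraMap_X
  obtain ⟨z, hz⟩ := cyclotomic_mul_dvd_mixed_truncNum hd hN hN' φ
    ⟨w₀, hw₀⟩ ⟨w₁, hw₁⟩ ⟨b₀, hb₀⟩ ⟨b₁, hb₁⟩
  have h := congrArg (locAt ζ).subtype hz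
  simp only [map_add, map_sub, map_mul, map_truncNum, map_denW, map_denB, hφ] at h
  simp only [Subring.subtype_apply] at h
  rw [h]
  exact ((locDvd_cyclotomic hζ (by lia)).mul (he.mul hf)).mul_right z.2

theorem locDvd_cross_truncNum (hζ : IsPrimitiveRoot ζ d) (hd : d % 2 = 1)
    (hN : (d - 1) / 2 ≤ N) (hN' : N < d) {w b₀ b₁ : RatFunc ℚ} (hw : w ∈ locAt ζ)
    (hb₀ : b₀ ∈ locAt ζ) (hb₁ : b₁ ∈ locAt ζ) {f : ℕ} (hf : LocDvd ζ f (b₀ - b₁)) :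
    LocDvd ζ (1 + f)
      (truncNum RatFunc.X w b₀ N * denB RatFunc.X b₁ N -
      truncNum RatFunc.X w b₁ N * denB RatFunc.X b₀ N) := by
  let φ : ℚ[X] →+* locAt ζ :=
    (algebraMap ℚ[X] (RatFunc ℚ)).codRestrict (locAt ζ) algebraMap_mem_locAt
  have hφ : (locAt ζ).subtype (φ X) = RatFunc.X := RatFunc.algebraMap_X
  obtain ⟨z, hz⟩ := cyclotomic_mul_dvd_cross_truncNum hd hN hN' φ ⟨w, hw⟩ ⟨b₀, hb₀⟩ ⟨b₁, hb₁⟩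
  have h := congrArg (locAt ζ).subtype hz
  simp only [map_sub, map_mul, map_truncNum, map_denB, hφ] at h
  simp only [Subring.subtype_apply] at h
  rw [h]
  exact ((locDvd_cyclotomic hζ (by lia)).mul hf).mul_right z.2

variable {K : Type*} [Field K]

theorem sum_termNum_div {q w b : K} {N : ℕ}
    (h : denQ q N * denW q w N * denB q b N ≠ 0) :
    ∑ k ∈ range (N + 1), termNum q w b k / (denQ q k * denW q w k * denB q b k) =
      truncNum q w b N / (denQ q N * denW q w N * denB q b N) := by
  induction N with
  | zero => simp [termNum, truncNum, denQ, denW, denB]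
  | succ N ih =>
    have h' := h
    simp only [denQ, denW, denB, prod_range_succ] at h'
    simp only [mul_ne_zero_iff] at h'
    obtain ⟨⟨⟨h1, h2⟩, h3, h4⟩, h5, h6⟩ := h'
    rw [sum_range_succ, ih (by simp only [denQ, denW, denB]; simp [h1, h3, h5]), truncNum, add_div]
    congr 1
    simp only [denQ, denW, denB, prod_range_succ]
    rw [div_eq_div_iff (by simp [h1, h3, h5]) (by simp [h1, h2, h3, h4, h5, h6])]
    ring

end LocalTruncNum

section Main

variable {ζ : ℂ} {m : ℕ}

theorem denW_eq_prod_mul {q w : RatFunc ℚ} (hq : ∀ k ≠ 0, 1 - q ^ k ≠ 0) (N : ℕ) :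
    denW q w N = (∏ i ∈ range N, (1 - q ^ (4 * i + 4))) ^ 2 *
      ∏ i ∈ range N, (1 - (w - 2) * (q ^ (4 * i + 4) * ((1 - q ^ (4 * i + 4))⁻¹) ^ 2)) := by
  rw [denW, ← prod_pow, ← prod_mul_distrib]
  refine prod_congr rfl fun i _ => ?_
  have := hq (4 * i + 4) (by lia)
  rw [show 8 * i + 8 = (4 * i + 4) * 2 by ring, pow_mul]
  field_simp
  ring

/-- The partial sum `∑ q^{4j} / (1 - q^{4j})²`. -/
noncomputable def lambertSum (q : RatFunc ℚ) (m : ℕ) : RatFunc ℚ :=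
  ∑ i ∈ range m, q ^ (4 * i + 4) * ((1 - q ^ (4 * i + 4))⁻¹) ^ 2

theorem not_dvd_of_lt {n i c : ℕ} (hc : Nat.Coprime n c) (hi : i + 1 < n) : ¬ n ∣ c * (i + 1) :=
  fun h => absurd (Nat.le_of_dvd (by lia) (hc.dvd_of_dvd_mul_left h)) (by lia)

theorem inv_mem_of_not_dvd {n k : ℕ} (hζ : IsPrimitiveRoot ζ n) (hk : ¬ n ∣ k) :
    (1 - RatFunc.X ^ k)⁻¹ ∈ locAt ζ :=
  inv_one_sub_X_pow_mem_locAt fun h => hk (hζ.dvd_of_pow_eq_one _ h)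

theorem locDvd_truncNum_sub (hζ : IsPrimitiveRoot ζ (4 * m + 1)) :
    LocDvd ζ 4 (truncNum RatFunc.X 2 1 (2 * m) /
        (denQ RatFunc.X (2 * m) * denW RatFunc.X 2 (2 * m) * denB RatFunc.X 1 (2 * m)) -
      (1 - RatFunc.X ^ (4 * m + 1)) * (∏ i ∈ range m, (1 - RatFunc.X ^ (4 * i + 2))) /
        (RatFunc.X ^ m * ∏ i ∈ range m, (1 - RatFunc.X ^ (4 * i + 4))) *
        (1 - (1 - RatFunc.X ^ (4 * m + 1)) ^ 2 * lambertSum RatFunc.X m)) := by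
  set q : RatFunc ℚ := RatFunc.X with hqdef
  have hq0 : q ≠ 0 := RatFunc.X_ne_zero
  have hq : ∀ k ≠ 0, 1 - q ^ k ≠ 0 := fun k hk => one_sub_ratFunc_X_pow_ne_zero hk
  have hζ0 : ζ ≠ 0 := hζ.ne_zero (by lia)
  set b := q ^ (4 * m + 1) with hb
  set w := b + b⁻¹ with hw
  have hb0 : b ≠ 0 := pow_ne_zero _ hq0
  have hbm : b ∈ locAt ζ := X_pow_mem_locAt _
  have hbi : b⁻¹ ∈ locAt ζ := by rw [hb, ← inv_pow]; exact pow_mem (inv_X_mem_locAt hζ0) _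
  have hwm : w ∈ locAt ζ := add_mem hbm hbi
  have h2m : (2 : RatFunc ℚ) ∈ locAt ζ := ofNat_mem _ 2
  have ha : LocDvd ζ 1 (1 - b) := locDvd_one_sub_X_pow hζ.pow_eq_one
  have hε' : w - 2 = (1 - b) ^ 2 * b⁻¹ := by rw [hw]; field_simp; ring
  have hε : LocDvd ζ 2 (w - 2) := by rw [hε']; exact (ha.pow 2).mul_right hbi
  have c2 : Nat.Coprime (4 * m + 1) 2 := Nat.coprime_two_right.2 ⟨2 * m, by ring⟩
  have c4 : Nat.Coprime (4 * m + 1) 4 := by simp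
  have u4 {i : ℕ} (hi : i < 2 * m) : (1 - q ^ (4 * i + 4))⁻¹ ∈ locAt ζ := by
    refine inv_mem_of_not_dvd hζ ?_
    rw [show 4 * i + 4 = 4 * (i + 1) by ring]
    exact not_dvd_of_lt c4 (by lia)
  have x4 {i : ℕ} (hi : i < 2 * m) :
      q ^ (4 * i + 4) * ((1 - q ^ (4 * i + 4))⁻¹) ^ 2 ∈ locAt ζ :=
    mul_mem (X_pow_mem_locAt _) (pow_mem (u4 hi) 2)
  have hσ : lambertSum q m ∈ locAt ζ := sum_mem fun i hi => x4 (by simp at hi; lia)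
  have uQ : (denQ q (2 * m))⁻¹ ∈ locAt ζ := by
    rw [denQ, ← prod_inv_distrib]
    exact prod_mem fun i hi => u4 (mem_range.1 hi)
  have uW0 : (denW q 2 (2 * m))⁻¹ ∈ locAt ζ := by
    rw [denW_eq_prod_mul hq]
    simpa [denQ] using pow_mem uQ 2
  have uW1 : (denW q w (2 * m))⁻¹ ∈ locAt ζ := by
    rw [denW_eq_prod_mul hq, mul_inv, ← inv_pow]
    refine mul_mem (pow_mem uQ 2) ?_
    rw [← prod_inv_distrib]
    exact prod_mem fun i hi =>
      ((hε.of_le one_le_two).mul_right (x4 (mem_range.1 hi))).inv_one_sub_mem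
  have uB0 : (denB q 1 (2 * m))⁻¹ ∈ locAt ζ := by
    rw [denB, ← prod_inv_distrib]
    refine prod_mem fun i hi => ?_
    rw [mul_one]
    refine inv_mem_of_not_dvd hζ ?_
    rw [show 2 * i + 2 = 2 * (i + 1) by ring]
    exact not_dvd_of_lt c2 (by simp at hi; lia)
  have uB1 : (denB q b (2 * m))⁻¹ ∈ locAt ζ := by
    rw [denB, ← prod_inv_distrib]
    refine prod_mem fun i hi => ?_
    rw [hb, ← pow_add]
    refine inv_mem_of_not_dvd hζ ?_
    rw [Nat.dvd_add_left (dvd_refl _), show 2 * i + 2 = 2 * (i + 1) by ring]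
    exact not_dvd_of_lt c2 (by simp at hi; lia)
  have nQ : denQ q (2 * m) ≠ 0 := prod_ne_zero_iff.2 fun i _ => hq _ (by lia)
  have nB0 : denB q 1 (2 * m) ≠ 0 := prod_ne_zero_iff.2 fun i _ => by
    rw [mul_one]; exact hq _ (by lia)
  have nB1 : denB q b (2 * m) ≠ 0 := prod_ne_zero_iff.2 fun i _ => by
    rw [hb, ← pow_add]; exact hq _ (by lia)
  have nx {w' : RatFunc ℚ} (h : LocDvd ζ 1 (w' - 2)) (N : ℕ) (hN : N ≤ 2 * m) :
      denW q w' N ≠ 0 := by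
    rw [denW_eq_prod_mul hq]
    refine mul_ne_zero (pow_ne_zero _ (prod_ne_zero_iff.2 fun i _ => hq _ (by lia))) ?_
    refine prod_ne_zero_iff.2 fun i hi h0 => ?_
    rw [mem_range] at hi
    exact (h.mul_right (x4 (hi.trans_le hN))).ne_one (sub_eq_zero.1 h0).symm
  have nW0 (N : ℕ) : denW q 2 N ≠ 0 := by
    rw [denW_eq_prod_mul hq]
    simpa using pow_ne_zero 2 (prod_ne_zero_iff.2 fun i _ => hq _ (by lia))
  have nW1 (N : ℕ) (hN : N ≤ 2 * m) : denW q w N ≠ 0 := nx (hε.of_le one_le_two) N hN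
  set P : RatFunc ℚ → RatFunc ℚ → RatFunc ℚ := fun w' b' => truncNum q w' b' (2 * m) with hP
  have hmix : LocDvd ζ 4 (P 2 1 / (denQ q (2 * m) * denW q 2 (2 * m) * denB q 1 (2 * m)) -
      P w 1 / (denQ q (2 * m) * denW q w (2 * m) * denB q 1 (2 * m)) -
      P 2 b / (denQ q (2 * m) * denW q 2 (2 * m) * denB q b (2 * m)) +
      P w b / (denQ q (2 * m) * denW q w (2 * m) * denB q b (2 * m))) := by
    have h1 := locDvd_mixed_truncNum hζ (by lia) (N := 2 * m) (by lia) (by lia) h2m hwm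
      (one_mem _) hbm (e := 2) (f := 1) (by rw [← neg_sub]; exact hε.neg) ha
    have h2 := h1.mul_right (mul_mem uQ (mul_mem (mul_mem uW0 uW1) (mul_mem uB0 uB1)))
    convert h2 using 1
    have := nW0 (2 * m)
    have := nW1 (2 * m) le_rfl
    simp only [hP, ← hqdef]
    field_simp
  have hcross : LocDvd ζ 2
      (P w 1 / (denQ q (2 * m) * denW q w (2 * m) * denB q 1 (2 * m)) -
      P w b / (denQ q (2 * m) * denW q w (2 * m) * denB q b (2 * m))) := by
    have h1 := locDvd_cross_truncNum hζ (by lia) (N := 2 * m) (by lia) (by lia) hwm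
      (one_mem _) hbm (f := 1) ha
    have h2 := h1.mul_right (mul_mem uQ (mul_mem uW1 (mul_mem uB0 uB1)))
    convert h2 using 1
    have := nW1 (2 * m) le_rfl
    simp only [hP, ← hqdef]
    field_simp
  have hA : P w 1 / (denQ q (2 * m) * denW q w (2 * m) * denB q 1 (2 * m)) =
      (1 - b) * (∏ i ∈ range m, (1 - q ^ (4 * i + 2))) /
        (q ^ m * ∏ i ∈ range m, (1 - q ^ (4 * i + 4))) := by
    have n4 : ∏ i ∈ range m, (1 - q ^ (4 * i + 4)) ≠ 0 :=
      prod_ne_zero_iff.2 fun i _ => hq _ (by lia)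
    rw [div_eq_div_iff (mul_ne_zero (mul_ne_zero nQ (nW1 _ le_rfl)) nB0)
      (mul_ne_zero (pow_ne_zero _ hq0) n4)]
    exact truncNum_one hq0 hq hw
  have hAd : LocDvd ζ 1 (P w 1 / (denQ q (2 * m) * denW q w (2 * m) * denB q 1 (2 * m))) := by
    rw [hA, mul_div_assoc]
    refine ha.mul_right ?_
    rw [div_eq_mul_inv, mul_inv, ← prod_inv_distrib, ← inv_pow]
    exact mul_mem (prod_mem fun i _ => one_sub_X_pow_mem_locAt _)
      (mul_mem (pow_mem (inv_X_mem_locAt hζ0) _)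
        (prod_mem fun i hi => u4 (by simp at hi; lia)))
  have hB : P 2 b / (denQ q (2 * m) * denW q 2 (2 * m) * denB q b (2 * m)) =
      P w b / (denQ q (2 * m) * denW q w (2 * m) * denB q b (2 * m)) *
        ∏ i ∈ range m, (1 - (w - 2) * (q ^ (4 * i + 4) * ((1 - q ^ (4 * i + 4))⁻¹) ^ 2)) := by
    have h1 := truncNum_pow q 2 (N := 2 * m) (j := m) (by lia)
    have h2 := truncNum_pow q w (N := 2 * m) (j := m) (by lia)
    have h3 : denW q w m = denW q 2 m *
        ∏ i ∈ range m, (1 - (w - 2) * (q ^ (4 * i + 4) * ((1 - q ^ (4 * i + 4))⁻¹) ^ 2)) := by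
      rw [denW_eq_prod_mul hq, denW_eq_prod_mul (w := 2) hq]
      simp
    have n0 := nW0 m
    have n1 := nW0 (2 * m)
    have n2 := nW1 (2 * m) le_rfl
    rw [h3] at h2
    rw [← hb] at h1 h2
    refine mul_left_cancel₀ n0 ?_
    rw [mul_div_assoc', h1, mul_div_cancel_right₀ _ (mul_ne_zero (mul_ne_zero nQ n1) nB1)]
    rw [div_mul_eq_mul_div, mul_div_assoc', eq_div_iff (mul_ne_zero (mul_ne_zero nQ n2) nB1), ← h2]
    ring
  set T := P 2 1 / (denQ q (2 * m) * denW q 2 (2 * m) * denB q 1 (2 * m))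
  set A := P w 1 / (denQ q (2 * m) * denW q w (2 * m) * denB q 1 (2 * m))
  set B₁ := P w b / (denQ q (2 * m) * denW q w (2 * m) * denB q b (2 * m))
  have hpi := LocDvd.prod_one_sub (range m) (e := 2) (ζ := ζ)
    (g := fun i => (w - 2) * (q ^ (4 * i + 4) * ((1 - q ^ (4 * i + 4))⁻¹) ^ 2))
    fun i hi => hε.mul_right (x4 (by simp at hi; lia))
  rw [← mul_sum, ← lambertSum] at hpi
  rw [hB] at hmix
  have hB₁ : B₁ ∈ locAt ζ := by
    convert sub_mem hAd.mem hcross.mem using 1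
    ring
  rw [← hA]
  have h5 : LocDvd ζ 2 (A - B₁ - A * (1 - b)) := hcross.sub (hAd.mul ha)
  have h6 : LocDvd ζ 4 ((w - 2) * (A - B₁ - A * (1 - b)) * lambertSum q m) :=
    (hε.mul h5).mul_right hσ
  have h7 := (hmix.add (hpi.mul_left hB₁)).add h6
  convert h7 using 1
  have h8 : (1 - b) ^ 2 = (w - 2) * b := by rw [hε']; field_simp
  rw [h8]
  ring

end Main

section Congruence

variable {ζ : ℂ} {d : ℕ}

/-- Congruence modulo the maximal ideal of the local ring at `ζ`. -/
def LocCongr (ζ : ℂ) (x y : RatFunc ℚ) : Prop :=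
  x ∈ locAt ζ ∧ y ∈ locAt ζ ∧ LocDvd ζ 1 (x - y)

variable {x y x' y' : RatFunc ℚ}

theorem LocCongr.refl (hx : x ∈ locAt ζ) : LocCongr ζ x x :=
  ⟨hx, hx, 0, zero_mem _, by simp⟩

theorem LocCongr.mul (h : LocCongr ζ x y) (h' : LocCongr ζ x' y') :
    LocCongr ζ (x * x') (y * y') := by
  refine ⟨mul_mem h.1 h'.1, mul_mem h.2.1 h'.2.1, ?_⟩
  convert (h.2.2.mul_right h'.1).add (h'.2.2.mul_left h.2.1) using 1
  ring

theorem LocCongr.sub (h : LocCongr ζ x y) (h' : LocCongr ζ x' y') :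
    LocCongr ζ (x - x') (y - y') := by
  refine ⟨sub_mem h.1 h'.1, sub_mem h.2.1 h'.2.1, ?_⟩
  convert h.2.2.sub h'.2.2 using 1
  ring

theorem LocCongr.pow (h : LocCongr ζ x y) (k : ℕ) : LocCongr ζ (x ^ k) (y ^ k) := by
  induction k with
  | zero => simpa using LocCongr.refl (one_mem _)
  | succ k ih => rw [pow_succ, pow_succ]; exact ih.mul h

theorem LocCongr.prod {ι : Type*} {s : Finset ι} {f g : ι → RatFunc ℚ}
    (h : ∀ i ∈ s, LocCongr ζ (f i) (g i)) : LocCongr ζ (∏ i ∈ s, f i) (∏ i ∈ s, g i) := by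
  classical
  induction s using Finset.induction_on with
  | empty => simpa using LocCongr.refl (one_mem _)
  | insert a s ha ih =>
    rw [prod_insert ha, prod_insert ha]
    exact (h a (mem_insert_self _ _)).mul (ih fun i hi => h i (mem_insert_of_mem hi))

theorem LocCongr.inv (h : LocCongr ζ x y) (hx : x⁻¹ ∈ locAt ζ) (hy : y⁻¹ ∈ locAt ζ)
    (hx0 : x ≠ 0) (hy0 : y ≠ 0) : LocCongr ζ x⁻¹ y⁻¹ := by
  refine ⟨hx, hy, ?_⟩
  convert h.2.2.neg.mul_right (mul_mem hx hy) using 1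
  field_simp
  ring

theorem locCongr_X_pow (hζ : IsPrimitiveRoot ζ d) {a b : ℕ} (h : d ∣ a) :
    LocCongr ζ (RatFunc.X ^ (a + b)) (RatFunc.X ^ b) := by
  refine ⟨X_pow_mem_locAt _, X_pow_mem_locAt _, ?_⟩
  have h1 := (locDvd_one_sub_X_pow ((hζ.pow_eq_one_iff_dvd a).2 h)).neg.mul_right
    (X_pow_mem_locAt b)
  convert h1 using 1
  ring

theorem locCongr_one_sub_X_pow (hζ : IsPrimitiveRoot ζ d) {a b : ℕ} (h : d ∣ a) :
    LocCongr ζ (1 - RatFunc.X ^ (a + b)) (1 - RatFunc.X ^ b) :=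
  (LocCongr.refl (one_mem _)).sub (locCongr_X_pow hζ h)

end Congruence

section Series

variable {ζ : ℂ} {d : ℕ}

/-- The quotient of shifted factorials in the `k`-th term of the series. -/
noncomputable def pochQuot (q : RatFunc ℚ) (k : ℕ) : RatFunc ℚ :=
  ∏ i ∈ range k, ((1 - q ^ (2 * i + 1)) ^ 3 * (1 - q ^ (4 * i + 1)) *
    (((1 - q ^ (4 * i + 4))⁻¹) ^ 3 * (1 - q ^ (2 * i + 2))⁻¹))

theorem termNum_div_eq (q : RatFunc ℚ) (k : ℕ) :
    termNum q 2 1 k / (denQ q k * denW q 2 k * denB q 1 k) =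
      (1 - q ^ (6 * k + 1)) * q ^ (k ^ 2 + k) * pochQuot q k := by
  rw [termNum, denQ, denW, denB, pochQuot, ← prod_mul_distrib, ← prod_mul_distrib, mul_div_assoc,
    ← prod_div_distrib]
  congr 1
  refine prod_congr rfl fun i _ => ?_
  rw [div_eq_mul_inv]
  have e1 : 1 - q ^ (2 * i + 1) * 2 + q ^ (4 * i + 2) = (1 - q ^ (2 * i + 1)) ^ 2 := by ring
  have e2 : 1 - q ^ (4 * i + 4) * 2 + q ^ (8 * i + 8) = (1 - q ^ (4 * i + 4)) ^ 2 := by ring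
  rw [e1, e2, mul_one, mul_inv, mul_inv, ← inv_pow]
  ring

theorem pochQuot_mem_locAt (hζ : IsPrimitiveRoot ζ d) (hd : d % 2 = 1) (k : ℕ) :
    pochQuot RatFunc.X k ∈ locAt ζ := by
  have c2 : Nat.Coprime 2 d := Nat.coprime_two_left.2 (Nat.odd_iff.2 hd)
  have c4 : Nat.Coprime 4 d := by
    rw [show 4 = 2 * 2 by rfl]; exact Nat.Coprime.mul_left c2 c2
  have h1 := prod_div_prod_mem_locAt hζ (by lia) two_ne_zero c2 1 k
  have h2 := prod_div_prod_mem_locAt hζ (by lia) four_ne_zero c4 1 k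
  have h3 : ∏ i ∈ range k, (1 - (-1) * RatFunc.X ^ (2 * i + 2))⁻¹ ∈ locAt ζ := by
    refine prod_mem fun i _ => ?_
    have := inv_algebraMap_mem_locAt (ζ := ζ) (v := 1 - (-1) * X ^ (2 * i + 2)) ?_
    · simpa using this
    · intro h
      have h' : ζ ^ (2 * i + 2) = -1 := by
        simp at h; linear_combination h
      have h'' : (ζ ^ (2 * i + 2)) ^ d = 1 := by
        rw [← pow_mul, mul_comm, pow_mul]; simp [hζ.pow_eq_one]
      rw [h', Odd.neg_one_pow (Nat.odd_iff.2 hd)] at h''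
      norm_num at h''
  convert mul_mem (mul_mem (pow_mem h1 3) h2) (pow_mem h3 2) using 1
  rw [pochQuot, ← prod_inv_distrib, ← prod_inv_distrib, ← prod_mul_distrib, ← prod_mul_distrib,
    ← prod_pow, ← prod_pow, ← prod_mul_distrib, ← prod_mul_distrib]
  refine prod_congr rfl fun i _ => ?_
  have e1 : (1 - RatFunc.X ^ (4 * i + 4) : RatFunc ℚ) =
    (1 - RatFunc.X ^ (2 * i + 2)) * (1 - (-1) * RatFunc.X ^ (2 * i + 2)) := by ring
  have n1 : (1 - RatFunc.X ^ (4 * i + 4) : RatFunc ℚ) ≠ 0 :=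
    one_sub_ratFunc_X_pow_ne_zero (by lia)
  rw [e1] at n1 ⊢
  obtain ⟨n2, n3⟩ := mul_ne_zero_iff.1 n1
  rw [add_comm 1 (2 * i), add_comm 1 (4 * i)]
  field_simp

theorem pochQuot_add_sub (hζ : IsPrimitiveRoot ζ d) (hd : d % 2 = 1) {a r : ℕ} (ha : d ∣ a)
    (hr : r < d) :
    LocDvd ζ 1 ((1 - RatFunc.X ^ (6 * (a + r) + 1)) * RatFunc.X ^ ((a + r) ^ 2 + (a + r)) *
        pochQuot RatFunc.X (a + r) -
      pochQuot RatFunc.X a * ((1 - RatFunc.X ^ (6 * r + 1)) * RatFunc.X ^ (r ^ 2 + r) *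
        pochQuot RatFunc.X r)) := by
  have c2 : Nat.Coprime d 2 := Nat.coprime_two_right.2 (Nat.odd_iff.2 hd)
  have c4 : Nat.Coprime d 4 := by
    rw [show 4 = 2 * 2 by rfl]; exact Nat.Coprime.mul_right c2 c2
  have key {c i e : ℕ} : LocCongr ζ (1 - RatFunc.X ^ (c * (a + i) + e))
      (1 - RatFunc.X ^ (c * i + e)) := by
    rw [show c * (a + i) + e = c * a + (c * i + e) by ring]
    exact locCongr_one_sub_X_pow hζ (ha.mul_left c)
  have keyinv {c i : ℕ} (hc0 : c ≠ 0) (hc : Nat.Coprime d c) (hi : i + 1 < d) :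
      LocCongr ζ (1 - RatFunc.X ^ (c * (a + i) + c))⁻¹ (1 - RatFunc.X ^ (c * i + c))⁻¹ := by
    have h := not_dvd_of_lt hc hi
    refine key.inv (inv_mem_of_not_dvd hζ ?_) (inv_mem_of_not_dvd hζ ?_)
      (one_sub_ratFunc_X_pow_ne_zero (by lia)) (one_sub_ratFunc_X_pow_ne_zero (by lia))
    · rw [show c * (a + i) + c = c * a + c * (i + 1) by ring]
      rwa [Nat.dvd_add_right (ha.mul_left c)]
    · exact h
  have h1 : LocCongr ζ (∏ i ∈ range r, ((1 - RatFunc.X ^ (2 * (a + i) + 1)) ^ 3 *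
      (1 - RatFunc.X ^ (4 * (a + i) + 1)) * (((1 - RatFunc.X ^ (4 * (a + i) + 4))⁻¹) ^ 3 *
      (1 - RatFunc.X ^ (2 * (a + i) + 2))⁻¹))) (pochQuot RatFunc.X r) := by
    refine LocCongr.prod fun i hi => ?_
    rw [mem_range] at hi
    exact ((key.pow 3).mul key).mul
      (((keyinv four_ne_zero c4 (by lia)).pow 3).mul (keyinv two_ne_zero c2 (by lia)))
  have h2 : LocCongr ζ (RatFunc.X ^ ((a + r) ^ 2 + (a + r))) (RatFunc.X ^ (r ^ 2 + r)) := by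
    rw [show (a + r) ^ 2 + (a + r) = a * (a + 2 * r + 1) + (r ^ 2 + r) by ring]
    exact locCongr_X_pow hζ (ha.mul_right _)
  have h3 := (((key (c := 6) (i := r) (e := 1)).mul h2).mul h1).2.2
  convert h3.mul_left (pochQuot_mem_locAt hζ hd a) using 1
  rw [show pochQuot RatFunc.X (a + r) = pochQuot RatFunc.X a * _ from prod_range_add _ _ _]
  ring

theorem inv_denoms_mem (hζ : IsPrimitiveRoot ζ d) (hd : d % 2 = 1) {N : ℕ} (hN : N < d) :
    (denQ RatFunc.X N * denW RatFunc.X 2 N * denB RatFunc.X 1 N)⁻¹ ∈ locAt ζ := by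
  have c2 : Nat.Coprime d 2 := Nat.coprime_two_right.2 (Nat.odd_iff.2 hd)
  have c4 : Nat.Coprime d 4 := by
    rw [show 4 = 2 * 2 by rfl]; exact Nat.Coprime.mul_right c2 c2
  have u {c i : ℕ} (hc : Nat.Coprime d c) (hi : i < N) :
      (1 - RatFunc.X ^ (c * i + c))⁻¹ ∈ locAt ζ :=
    inv_mem_of_not_dvd hζ (not_dvd_of_lt hc (by lia))
  have hQ : (denQ RatFunc.X N)⁻¹ ∈ locAt ζ := by
    rw [denQ, ← prod_inv_distrib]
    exact prod_mem fun i hi => u c4 (mem_range.1 hi)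
  have hB : (denB RatFunc.X 1 N)⁻¹ ∈ locAt ζ := by
    rw [denB, ← prod_inv_distrib]
    exact prod_mem fun i hi => by rw [mul_one]; exact u c2 (mem_range.1 hi)
  rw [denW_eq_prod_mul fun k hk => one_sub_ratFunc_X_pow_ne_zero hk, mul_inv, mul_inv]
  refine mul_mem (mul_mem hQ ?_) hB
  simpa [denQ] using pow_mem hQ 2

theorem denoms_ne_zero (N : ℕ) :
    denQ (RatFunc.X : RatFunc ℚ) N * denW RatFunc.X 2 N * denB RatFunc.X 1 N ≠ 0 := by
  have hq : ∀ k ≠ 0, (1 - RatFunc.X ^ k : RatFunc ℚ) ≠ 0 :=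
    fun k hk => one_sub_ratFunc_X_pow_ne_zero hk
  have hQ : denQ (RatFunc.X : RatFunc ℚ) N ≠ 0 := prod_ne_zero_iff.2 fun i _ => hq _ (by lia)
  rw [denW_eq_prod_mul hq]
  refine mul_ne_zero (mul_ne_zero hQ ?_) (prod_ne_zero_iff.2 fun i _ => ?_)
  · simpa [denQ] using pow_ne_zero 2 hQ
  · rw [mul_one]; exact hq _ (by lia)

/-- The `k`-th term of the series multiplied by `1 - q`. -/
noncomputable def serTerm (k : ℕ) : RatFunc ℚ :=
  (1 - RatFunc.X ^ (6 * k + 1)) * RatFunc.X ^ (k ^ 2 + k) * pochQuot RatFunc.X k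

theorem locDvd_sum_serTerm (hζ : IsPrimitiveRoot ζ d) (hd : d % 2 = 1) {N : ℕ}
    (hN : (d - 1) / 2 ≤ N) (hN' : N < d) : LocDvd ζ 1 (∑ k ∈ range (N + 1), serTerm k) := by
  simp only [serTerm, ← termNum_div_eq]
  rw [sum_termNum_div (denoms_ne_zero N), div_eq_mul_inv]
  refine LocDvd.mul_right ?_ (inv_denoms_mem hζ hd hN')
  have h := locDvd_algebraMap (ζ := ζ) (u := truncNum X 2 1 N) ?_
  · simpa [map_truncNum, map_ofNat (algebraMap ℚ[X] (RatFunc ℚ)) 2] using h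
  · have := map_truncNum (aeval (R := ℚ) ζ).toRingHom X 2 1 N
    simp [map_ofNat (aeval (R := ℚ) ζ) 2] at this
    rw [this]
    exact truncNum_eq_zero_of_isPrimitiveRoot hζ hd hN hN' 2 1

theorem locDvd_sum_serTerm_block (hζ : IsPrimitiveRoot ζ d) (hd : d % 2 = 1) {N a : ℕ}
    (hN : (d - 1) / 2 ≤ N) (hN' : N < d) (ha : d ∣ a) :
    LocDvd ζ 1 (∑ r ∈ range (N + 1), serTerm (a + r)) := by
  have h := (LocDvd.sum fun r (hr : r ∈ range (N + 1)) =>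
    pochQuot_add_sub hζ hd ha (r := r) (by simp at hr; lia)).add
    ((locDvd_sum_serTerm hζ hd hN hN').mul_left (pochQuot_mem_locAt hζ hd a))
  convert h using 1
  rw [sum_sub_distrib, mul_sum]
  simp [serTerm]

theorem locDvd_sum_serTerm_full (hζ : IsPrimitiveRoot ζ d) (hd : d % 2 = 1) (L : ℕ) :
    LocDvd ζ 1 (∑ k ∈ range (d * L), serTerm k) := by
  induction L with
  | zero => exact ⟨0, zero_mem _, by simp⟩
  | succ L ih =>
    rw [mul_add, mul_one, sum_range_add]
    refine ih.add ?_
    have := locDvd_sum_serTerm_block hζ hd (N := d - 1) (a := d * L) (by lia) (by lia)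
      (dvd_mul_right _ _)
    rwa [Nat.sub_add_cancel (by lia)] at this

theorem locDvd_sum_serTerm_of_dvd (hζ : IsPrimitiveRoot ζ d) {n M : ℕ} (hdn : d ∣ n)
    (hn : n % 2 = 1) (hM : M = (n - 1) / 2 ∨ M = n - 1) :
    LocDvd ζ 1 (∑ k ∈ range (M + 1), serTerm k) := by
  obtain ⟨e, rfl⟩ := hdn
  have hd : d % 2 = 1 := Nat.odd_iff.1 (Nat.odd_mul.1 (Nat.odd_iff.2 hn)).1
  have he : e % 2 = 1 := Nat.odd_iff.1 (Nat.odd_mul.1 (Nat.odd_iff.2 hn)).2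
  rcases hM with rfl | rfl
  · obtain ⟨l, rfl⟩ : ∃ l, e = 2 * l + 1 := ⟨e / 2, by lia⟩
    have : (d * (2 * l + 1) - 1) / 2 + 1 = d * l + ((d - 1) / 2 + 1) := by
      rw [mul_add, mul_one, show d * (2 * l) = 2 * (d * l) by ring]; lia
    rw [this, sum_range_add]
    exact (locDvd_sum_serTerm_full hζ hd l).add
      (locDvd_sum_serTerm_block hζ hd le_rfl (by lia) (dvd_mul_right _ _))
  · rw [Nat.sub_add_cancel (by lia)]
    exact locDvd_sum_serTerm_full hζ hd e

theorem locDvd_serTerm {m k : ℕ} (hζ : IsPrimitiveRoot ζ (4 * m + 1)) (hk : 2 * m < k)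
    (hk' : k ≤ 4 * m) : LocDvd ζ 4 (serTerm k) := by
  have c2 : Nat.Coprime (4 * m + 1) 2 := Nat.coprime_two_right.2 ⟨2 * m, by ring⟩
  have c4 : Nat.Coprime (4 * m + 1) 4 := by simp
  have u {c i : ℕ} (hc : Nat.Coprime (4 * m + 1) c) (hi : i < k) :
      (1 - RatFunc.X ^ (c * i + c))⁻¹ ∈ locAt ζ :=
    inv_mem_of_not_dvd hζ (not_dvd_of_lt hc (by lia))
  have hp {c i : ℕ} (hi : i < k) (h : c * i + 1 = 4 * m + 1) :
      LocDvd ζ 1 (∏ i ∈ range k, (1 - RatFunc.X ^ (c * i + 1))) := by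
    rw [← mul_prod_erase _ _ (mem_range.2 hi), h]
    exact (locDvd_one_sub_X_pow hζ.pow_eq_one).mul_right
      (prod_mem fun i _ => one_sub_X_pow_mem_locAt _)
  rw [serTerm, pochQuot, prod_mul_distrib, prod_mul_distrib, prod_pow]
  refine LocDvd.mul_left (mul_mem (one_sub_X_pow_mem_locAt _) (X_pow_mem_locAt _))
    (LocDvd.mul_right ?_ ?_)
  · exact ((hp (i := 2 * m) hk (by ring)).pow 3).mul (hp (i := m) (by lia) (by ring))
  · exact prod_mem fun i hi => mul_mem (pow_mem (u c4 (mem_range.1 hi)) 3) (u c2 (mem_range.1 hi))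

/-- The right-hand side of the congruence multiplied by `1 - q`. -/
noncomputable def closedForm (m : ℕ) : RatFunc ℚ :=
  (1 - RatFunc.X ^ (4 * m + 1)) * (∏ i ∈ range m, (1 - RatFunc.X ^ (4 * i + 2))) /
    (RatFunc.X ^ m * ∏ i ∈ range m, (1 - RatFunc.X ^ (4 * i + 4))) *
    (1 - (1 - RatFunc.X ^ (4 * m + 1)) ^ 2 * lambertSum RatFunc.X m)

theorem locDvd_sum_serTerm_sub_closedForm {m M : ℕ} (hζ : IsPrimitiveRoot ζ (4 * m + 1))
    (hM : M = (4 * m + 1 - 1) / 2 ∨ M = 4 * m + 1 - 1) :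
    LocDvd ζ 4 (∑ k ∈ range (M + 1), serTerm k - closedForm m) := by
  have h : LocDvd ζ 4 (∑ k ∈ range (2 * m + 1), serTerm k - closedForm m) := by
    simp only [serTerm, ← termNum_div_eq]
    rw [sum_termNum_div (denoms_ne_zero _)]
    exact locDvd_truncNum_sub hζ
  rcases hM with rfl | rfl
  · rwa [show (4 * m + 1 - 1) / 2 = 2 * m by lia]
  · rw [show 4 * m + 1 - 1 + 1 = 2 * m + 1 + 2 * m by lia, sum_range_add, add_sub_right_comm]
    refine h.add (LocDvd.sum fun i hi => locDvd_serTerm hζ ?_ ?_) <;> simp at hi <;> lia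

theorem locDvd_closedForm {m : ℕ} (hζ : IsPrimitiveRoot ζ d) (hd : d ∣ 4 * m + 1) :
    LocDvd ζ 1 (closedForm m) := by
  have hd2 : Odd d := Odd.of_dvd_nat ⟨2 * m, by ring⟩ hd
  have hd0 : d ≠ 0 := hd2.pos.ne'
  have c2 : Nat.Coprime 2 d := Nat.coprime_two_left.2 hd2
  have c4 : Nat.Coprime 4 d := by
    rw [show 4 = 2 * 2 by rfl]; exact Nat.Coprime.mul_left c2 c2
  have h1 := prod_div_prod_mem_locAt hζ hd0 four_ne_zero c4 2 m
  have h2 : (1 - RatFunc.X ^ (4 * m + 1)) ^ 2 * lambertSum RatFunc.X m ∈ locAt ζ := by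
    rw [lambertSum, mul_sum]
    refine sum_mem fun i _ => ?_
    have h3 := div_one_sub_X_pow_mem_locAt hζ hd (c := 4 * i + 4) (by lia)
    convert mul_mem (pow_mem h3 2) (X_pow_mem_locAt (4 * i + 4)) using 1
    ring
  have h3 : LocDvd ζ 1 (1 - RatFunc.X ^ (4 * m + 1)) :=
    locDvd_one_sub_X_pow ((hζ.pow_eq_one_iff_dvd _).2 hd)
  have h4 := h3.mul_right (mul_mem (mul_mem h1 (pow_mem (inv_X_mem_locAt (hζ.ne_zero hd0)) m))
    (sub_mem (one_mem _) h2))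
  convert h4 using 1
  rw [closedForm, div_eq_mul_inv, mul_inv, inv_pow]
  simp only [add_comm 2]
  ring

end Series

section Conversion

theorem one_sub_mul_qint {K : Type*} [Field K] (q : K) (r : ℕ) :
    (1 - q) * qint q r = 1 - q ^ r := by
  rw [qint, mul_neg_geom_sum]

theorem one_sub_mul_summand (k : ℕ) :
    (1 - RatFunc.X) * (qint (RatFunc.X : RatFunc ℚ) (6 * k + 1) *
        qPoch RatFunc.X (RatFunc.X ^ 2) k ^ 3 * qPoch RatFunc.X (RatFunc.X ^ 4) k /
        (qPoch (RatFunc.X ^ 2) (RatFunc.X ^ 2) k *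
          qPoch (RatFunc.X ^ 4) (RatFunc.X ^ 4) k ^ 3) * RatFunc.X ^ (k ^ 2 + k)) =
      serTerm k := by
  have e (a c : ℕ) : qPoch ((RatFunc.X : RatFunc ℚ) ^ a) (RatFunc.X ^ c) k =
      ∏ i ∈ range k, (1 - RatFunc.X ^ (c * i + a)) := by
    rw [qPoch]
    exact prod_congr rfl fun i _ => by ring
  have e1 (c : ℕ) := e 1 c
  simp only [pow_one] at e1
  rw [e1, e1, e, e, serTerm, pochQuot, ← one_sub_mul_qint]
  simp only [prod_mul_distrib, prod_pow, prod_inv_distrib]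
  rw [div_eq_mul_inv, mul_inv, inv_pow]
  ring

theorem one_sub_mul_closedForm (m : ℕ) :
    (1 - RatFunc.X) * (qint (RatFunc.X : RatFunc ℚ) (4 * m + 1) *
      (RatFunc.X : RatFunc ℚ) ^ (-(m : ℤ)) *
      (qPoch ((RatFunc.X : RatFunc ℚ) ^ 2) (RatFunc.X ^ 4) m /
        qPoch ((RatFunc.X : RatFunc ℚ) ^ 4) (RatFunc.X ^ 4) m) *
      (1 - qint (RatFunc.X : RatFunc ℚ) (4 * m + 1) ^ 2 *
        ∑ j ∈ Icc 1 m, (RatFunc.X : RatFunc ℚ) ^ (4 * j) /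
          qint (RatFunc.X : RatFunc ℚ) (4 * j) ^ 2)) = closedForm m := by
  have h1 : (1 - RatFunc.X : RatFunc ℚ) ≠ 0 := by
    simpa using one_sub_ratFunc_X_pow_ne_zero one_ne_zero
  have e (a c : ℕ) : qPoch ((RatFunc.X : RatFunc ℚ) ^ a) (RatFunc.X ^ c) m =
      ∏ i ∈ range m, (1 - RatFunc.X ^ (c * i + a)) := by
    rw [qPoch]
    exact prod_congr rfl fun i _ => by ring
  have hq (r : ℕ) : qint (RatFunc.X : RatFunc ℚ) r = (1 - RatFunc.X ^ r) * (1 - RatFunc.X)⁻¹ := by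
    rw [← one_sub_mul_qint]; field_simp
  have hs : qint (RatFunc.X : RatFunc ℚ) (4 * m + 1) ^ 2 *
        ∑ j ∈ Icc 1 m, (RatFunc.X : RatFunc ℚ) ^ (4 * j) /
          qint (RatFunc.X : RatFunc ℚ) (4 * j) ^ 2 =
      (1 - RatFunc.X ^ (4 * m + 1)) ^ 2 * lambertSum RatFunc.X m := by
    rw [← Ico_add_one_right_eq_Icc, sum_Ico_eq_sum_range, lambertSum, mul_sum, mul_sum]
    refine sum_congr (by simp) fun i _ => ?_
    have h2 : (1 - RatFunc.X ^ (4 * i + 4) : RatFunc ℚ) ≠ 0 :=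
      one_sub_ratFunc_X_pow_ne_zero (by lia)
    rw [hq, hq, show 4 * (1 + i) = 4 * i + 4 by ring]
    field_simp
  rw [hs, closedForm, e, e, zpow_neg, zpow_natCast, ← one_sub_mul_qint _ (4 * m + 1),
    div_eq_mul_inv, div_eq_mul_inv, mul_inv]
  ring

theorem LocDvd.cyclotomic_pow_dvd_num {d e : ℕ} {x : RatFunc ℚ} (hd : 1 < d)
    (h : ∀ ζ : ℂ, IsPrimitiveRoot ζ d → LocDvd ζ e ((1 - RatFunc.X) * x)) :
    cyclotomic d ℚ ^ e ∣ x.num := by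
  have hζ := Complex.isPrimitiveRoot_exp d (by lia)
  rw [cyclotomic_eq_minpoly_rat hζ (by lia)]
  refine LocDvd.minpoly_pow_dvd_num ((hζ.isIntegral (by lia)).tower_top) ?_
  have h1 : ((1 : RatFunc ℚ) - RatFunc.X ^ 1)⁻¹ ∈
      locAt (Complex.exp (2 * Real.pi * Complex.I / d)) :=
    inv_one_sub_X_pow_mem_locAt (by simpa using hζ.ne_one hd)
  convert (h _ hζ).mul_right h1 using 1
  have := one_sub_ratFunc_X_pow_ne_zero one_ne_zero
  rw [pow_one] at this ⊢
  field_simp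

theorem geom_sum_mul_cyclotomic_pow_dvd {n e : ℕ} (hn : 1 < n) {p : ℚ[X]}
    (h1 : cyclotomic n ℚ ^ (e + 1) ∣ p) (h2 : ∀ d, 1 < d → d ∣ n → cyclotomic d ℚ ∣ p) :
    (∑ i ∈ range n, (X : ℚ[X]) ^ i) * cyclotomic n ℚ ^ e ∣ p := by
  have hmem : n ∈ n.divisors.erase 1 := by simp; lia
  rw [← prod_cyclotomic_eq_geom_sum (by lia), ← mul_prod_erase _ _ hmem, mul_right_comm,
    ← pow_succ']
  refine IsCoprime.mul_dvd ?_ h1 (prod_dvd_of_coprime ?_ ?_)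
  · refine IsCoprime.pow_left (IsCoprime.prod_right fun d hd => ?_)
    exact cyclotomic.isCoprime_rat (by simp at hd; lia)
  · exact fun a _ b _ hab => cyclotomic.isCoprime_rat hab
  · intro d hd
    simp only [mem_erase, Nat.mem_divisors] at hd
    refine h2 d ?_ hd.2.2.1
    have := Nat.pos_of_dvd_of_pos hd.2.2.1 (by lia)
    lia

end Conversion

theorem stmt_7 (n : ℕ) (hn : 0 < n) (h4 : n % 4 = 1) (M : ℕ)
    (hM : M = (n - 1) / 2 ∨ M = n - 1) :
    ((∑ i ∈ Finset.range n, (Polynomial.X : Polynomial ℚ) ^ i) *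
        Polynomial.cyclotomic n ℚ ^ 3) ∣
      ((∑ k ∈ Finset.range (M + 1),
          qint (RatFunc.X : RatFunc ℚ) (6 * k + 1) *
            qPoch RatFunc.X (RatFunc.X ^ 2) k ^ 3 *
            qPoch RatFunc.X (RatFunc.X ^ 4) k /
            (qPoch (RatFunc.X ^ 2) (RatFunc.X ^ 2) k *
              qPoch (RatFunc.X ^ 4) (RatFunc.X ^ 4) k ^ 3) *
            RatFunc.X ^ (k ^ 2 + k)) -
        qint (RatFunc.X : RatFunc ℚ) n *
          (RatFunc.X : RatFunc ℚ) ^ ((1 - (n : ℤ)) / 4) *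
          (qPoch ((RatFunc.X : RatFunc ℚ) ^ 2) (RatFunc.X ^ 4) ((n - 1) / 4) /
            qPoch ((RatFunc.X : RatFunc ℚ) ^ 4) (RatFunc.X ^ 4) ((n - 1) / 4)) *
          (1 - qint (RatFunc.X : RatFunc ℚ) n ^ 2 *
            ∑ j ∈ Finset.Icc 1 ((n - 1) / 4),
              (RatFunc.X : RatFunc ℚ) ^ (4 * j) /
                qint (RatFunc.X : RatFunc ℚ) (4 * j) ^ 2)).num := by
  obtain ⟨m, rfl⟩ : ∃ m, n = 4 * m + 1 := ⟨n / 4, by lia⟩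
  rw [show (1 - ((4 * m + 1 : ℕ) : ℤ)) / 4 = -(m : ℤ) by lia, show (4 * m + 1 - 1) / 4 = m by lia]
  rcases Nat.eq_zero_or_pos m with rfl | hm
  · obtain rfl : M = 0 := by lia
    simp [qint, qPoch]
  have key (x y : RatFunc ℚ) (e : ℕ) (ζ : ℂ)
      (h : LocDvd ζ e ((1 - RatFunc.X) * x - (1 - RatFunc.X) * y)) :
      LocDvd ζ e ((1 - RatFunc.X) * (x - y)) := by rwa [mul_sub]
  refine geom_sum_mul_cyclotomic_pow_dvd (by lia)
    (LocDvd.cyclotomic_pow_dvd_num (by lia) fun ζ hζ => key _ _ _ _ ?_)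
    fun d hd hdn => pow_one (cyclotomic d ℚ) ▸
      LocDvd.cyclotomic_pow_dvd_num hd fun ζ hζ => key _ _ _ _ ?_ <;>
  rw [mul_sum, one_sub_mul_closedForm, sum_congr rfl fun k _ => one_sub_mul_summand k]
  · exact locDvd_sum_serTerm_sub_closedForm hζ hM
  · exact (locDvd_sum_serTerm_of_dvd hζ hdn (by lia) hM).sub (locDvd_closedForm hζ hdn)
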